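/- arXiv:2012.15011 — 2 statements merged into one kernel-verified Lean document; each statement's English description precedes it below -/
import Mathlib

section
/- Let λ = (λ_1 ≥ … ≥ λ_ℓ ≥ 0) be a partition with at most ℓ parts and let x = (x_1,…,x_n), t = (t_1,…,t_{ℓ−1}). Then the refined dual Grothendieck polynomial satisfies the Jacobi–Trudi formula g_λ(x;t) = det[ h_{λ_i + j − i}(x_1,…,x_n, t_1,…,t_{i−1}) ]_{i,j=1}^{ℓ}, where the (i,j) entry is the complete homogeneous symmetric polynomial of degree λ_i + j − i in the n + i − 1 variables x_1,…,x_n, t_1,…,t_{i−1} (with h_d = 0 for d < 0 and h_0 = 1). -/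
open scoped Classical

noncomputable section

variable {R : Type*} [CommRing R]

/-- The boxes of the Young diagram with row lengths `lam 0, …, lam (ℓ-1)`
(a box in row `r < ℓ` and column `c < lam r`, both 0-indexed). -/
abbrev YBox (ℓ : ℕ) (lam : ℕ → ℕ) : Type := Σ r : Fin ℓ, Fin (lam r.1)

/-- A reverse plane partition of skew shape `lam/mu` with entries in `{1, …, n}`,
encoded as a filling of the boxes of `lam` by values in `Fin (n+1)`, where the
value `0` is used exactly on the boxes of `mu`; rows weakly increase and
columns weakly increase. -/
def IsSkewRPP (ℓ n : ℕ) (lam mu : ℕ → ℕ) (T : YBox ℓ lam → Fin (n + 1)) : Prop :=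
  (∀ b : YBox ℓ lam, ((T b : ℕ) = 0 ↔ (b.2 : ℕ) < mu b.1.1)) ∧
  (∀ (r : Fin ℓ) (c c' : Fin (lam r.1)), mu r.1 ≤ (c : ℕ) → (c : ℕ) ≤ (c' : ℕ) →
    T ⟨r, c⟩ ≤ T ⟨r, c'⟩) ∧
  (∀ (r r' : Fin ℓ) (c : Fin (lam r.1)) (c' : Fin (lam r'.1)),
    (r : ℕ) ≤ (r' : ℕ) → (c : ℕ) = (c' : ℕ) → mu r.1 ≤ (c : ℕ) → mu r'.1 ≤ (c' : ℕ) →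
    T ⟨r, c⟩ ≤ T ⟨r', c'⟩)

/-- The weight of a box `b` of the skew shape `lam/mu` in a reverse plane
partition `T`: it is `t (r+1)` (`r+1` being the 1-indexed row of `b`) if the box
directly below `b` exists (in `lam`) and carries the same entry, and `x e`
otherwise, where `e ∈ {1, …, n}` is the entry of `b`.  Boxes of `mu` have
weight `1`. -/
def boxWeight (ℓ n : ℕ) (lam mu : ℕ → ℕ) (x t : ℕ → R)
    (T : YBox ℓ lam → Fin (n + 1)) (b : YBox ℓ lam) : R :=
  if mu b.1.1 ≤ (b.2 : ℕ) then
    if ∃ (hr : (b.1 : ℕ) + 1 < ℓ) (hc : (b.2 : ℕ) < lam ((b.1 : ℕ) + 1)),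
        T ⟨⟨(b.1 : ℕ) + 1, hr⟩, ⟨(b.2 : ℕ), hc⟩⟩ = T b
      then t ((b.1 : ℕ) + 1)
      else x (T b : ℕ)
  else 1

/-- The (skew) refined dual Grothendieck polynomial `g_{lam/mu}(x; t)`:
the sum of `∏_r t_r^{b_r(T)} ∏_i x_i^{a_i(T)}` over all reverse plane
partitions `T` of shape `lam/mu` with entries in `{1, …, n}`, where `b_r(T)`
is the number of boxes in row `r` whose entry equals that of the box directly
below it, and `a_i(T)` is the number of columns containing the entry `i`. -/
def dualGroth (ℓ n : ℕ) (lam mu : ℕ → ℕ) (x t : ℕ → R) : R :=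
  ∑ T ∈ Finset.univ.filter (IsSkewRPP ℓ n lam mu),
    ∏ b : YBox ℓ lam, boxWeight ℓ n lam mu x t T b

/-- Complete homogeneous symmetric function `h_k` of the entries of a list. -/
def hL (k : ℕ) (L : List R) : R :=
  ∑ f ∈ Finset.univ.filter (fun f : Fin k → Fin L.length => Monotone f),
    ∏ i, L.get (f i)

/-- Elementary symmetric function `e_k` of the entries of a list. -/
def eL (k : ℕ) (L : List R) : R :=
  ∑ f ∈ Finset.univ.filter (fun f : Fin k → Fin L.length => StrictMono f),
    ∏ i, L.get (f i)

/-- `h_d` for an integer degree `d`, with `h_d = 0` for `d < 0`. -/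
def hInt (d : ℤ) (L : List R) : R := if 0 ≤ d then hL d.toNat L else 0

/-- `e_d` for an integer degree `d`, with `e_d = 0` for `d < 0`. -/
def eInt (d : ℤ) (L : List R) : R := if 0 ≤ d then eL d.toNat L else 0

/-- Extend a function on `Fin ℓ` to `ℕ` by `0`. -/
def extendFin (ℓ : ℕ) (p : Fin ℓ → ℕ) : ℕ → ℕ :=
  fun r => if h : r < ℓ then p ⟨r, h⟩ else 0

/-- A semistandard Young tableau of shape `lam` with entries in `{1, …, N}`
(encoded with values in `Fin (N+1)`, the value `0` being unused): rows weakly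
increase and columns strictly increase. -/
def IsSSYT (ℓ N : ℕ) (lam : ℕ → ℕ) (T : YBox ℓ lam → Fin (N + 1)) : Prop :=
  (∀ b : YBox ℓ lam, 1 ≤ (T b : ℕ)) ∧
  (∀ (r : Fin ℓ) (c c' : Fin (lam r.1)), (c : ℕ) ≤ (c' : ℕ) → T ⟨r, c⟩ ≤ T ⟨r, c'⟩) ∧
  (∀ (r r' : Fin ℓ) (c : Fin (lam r.1)) (c' : Fin (lam r'.1)),
    (r : ℕ) < (r' : ℕ) → (c : ℕ) = (c' : ℕ) → T ⟨r, c⟩ < T ⟨r', c'⟩)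

/-- The Schur polynomial `s_lam (z 1, …, z N)`: the sum of `z^T` over all
semistandard Young tableaux of shape `lam` with entries in `{1, …, N}`. -/
def schurPoly (ℓ N : ℕ) (lam : ℕ → ℕ) (z : ℕ → R) : R :=
  ∑ T ∈ Finset.univ.filter (IsSSYT ℓ N lam),
    ∏ b : YBox ℓ lam, z (T b : ℕ)


lemma hL_zero (L : List R) : hL 0 L = 1 := by
  have h : (Finset.univ.filter (fun f : Fin 0 → Fin L.length => Monotone f)) = Finset.univ :=
    Finset.filter_true_of_mem fun f _ i => i.elim0
  rw [hL, h]
  simp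

lemma hL_succ_nil (k : ℕ) : hL (k + 1) ([] : List R) = 0 := by
  rw [hL]
  exact Finset.sum_eq_zero fun f _ => (f 0).elim0

lemma hL_succ_cons (k : ℕ) (a : R) (L : List R) :
    hL (k + 1) (a :: L) = hL (k + 1) L + a * hL k (a :: L) := by
  refine (Finset.sum_filter_add_sum_filter_not _
    (fun f : Fin (k + 1) → Fin (L.length + 1) => f 0 ≠ 0) _).symm.trans ?_
  congr 1
  · rw [hL]
    symm
    refine Finset.sum_bij (fun g _ i => (g i).succ) ?_ ?_ ?_ ?_
    · intro g hg
      simp only [Finset.mem_filter, Finset.mem_univ, true_and] at hg ⊢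
      exact ⟨fun i j hij => Fin.succ_le_succ_iff.2 (hg hij), Fin.succ_ne_zero _⟩
    · intro g _ g' _ h
      funext i
      exact Fin.succ_injective _ (congrFun h i)
    · intro f hf
      simp only [Finset.mem_filter, Finset.mem_univ, true_and] at hf
      have hne : ∀ i, f i ≠ 0 := fun i h =>
        hf.2 (le_antisymm (h ▸ hf.1 (Fin.zero_le i)) (Fin.zero_le _))
      refine ⟨fun i => (f i).pred (hne i), ?_, ?_⟩
      · simp only [Finset.mem_filter, Finset.mem_univ, true_and]
        exact fun i j hij => Fin.pred_le_pred_iff.2 (hf.1 hij)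
      · funext i
        exact Fin.succ_pred _ _
    · intro g _
      rfl
  · rw [hL, Finset.mul_sum]
    symm
    refine Finset.sum_bij
      (fun g _ => (Fin.cons 0 g : Fin (k + 1) → Fin (L.length + 1))) ?_ ?_ ?_ ?_
    · intro g hg
      simp only [Finset.mem_filter, Finset.mem_univ, true_and] at hg ⊢
      refine ⟨fun i j hij => ?_, by simp⟩
      induction i using Fin.cases with
      | zero => exact Fin.zero_le _
      | succ i =>
        induction j using Fin.cases with
        | zero => exact absurd hij (by simp)
        | succ j => exact hg (Fin.succ_le_succ_iff.1 hij)
    · intro g _ g' _ h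
      exact Fin.cons_right_injective (α := fun _ => Fin (L.length + 1)) 0 h
    · intro f hf
      simp only [Finset.mem_filter, Finset.mem_univ, true_and, not_not] at hf
      refine ⟨Fin.tail f, ?_, ?_⟩
      · simp only [Finset.mem_filter, Finset.mem_univ, true_and]
        exact fun i j hij => hf.1 (Fin.succ_le_succ_iff.2 hij)
      · rw [← hf.2]
        exact Fin.cons_self_tail f
    · intro g _
      rw [Fin.prod_univ_succ]
      rfl

lemma hL_cons_congr {L L' : List R} (h : ∀ k, hL k L = hL k L') (a : R) (k : ℕ) :
    hL k (a :: L) = hL k (a :: L') := by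
  induction k with
  | zero => rw [hL_zero, hL_zero]
  | succ k ih => rw [hL_succ_cons, hL_succ_cons, h, ih]

lemma hL_swap (k : ℕ) (a b : R) (L : List R) : hL k (a :: b :: L) = hL k (b :: a :: L) := by
  induction k using Nat.twoStepInduction with
  | zero => rw [hL_zero, hL_zero]
  | one => simp only [hL_succ_cons, hL_zero]; ring
  | more k ih₀ ih₁ =>
    have h₁ := hL_succ_cons k a (b :: L)
    have h₂ := hL_succ_cons k b (a :: L)
    rw [← ih₀, ← ih₁] at h₂
    rw [hL_succ_cons (k + 1) a, hL_succ_cons (k + 1) b, hL_succ_cons (k + 1) b,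
      hL_succ_cons (k + 1) a, ← ih₁]
    linear_combination a * h₂ - b * h₁

lemma hL_perm {L L' : List R} (h : L.Perm L') (k : ℕ) : hL k L = hL k L' := by
  induction h generalizing k with
  | nil => rfl
  | cons a _ ih => exact hL_cons_congr ih a k
  | swap a b L => exact hL_swap k b a L
  | trans _ _ ih₁ ih₂ => rw [ih₁, ih₂]

lemma hInt_of_neg {d : ℤ} (hd : d < 0) (L : List R) : hInt d L = 0 := if_neg (not_le.2 hd)

lemma hInt_zero (L : List R) : hInt 0 L = 1 := by simp [hInt, hL_zero]

lemma hInt_nil_of_pos {d : ℤ} (hd : 0 < d) : hInt d ([] : List R) = 0 := by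
  obtain ⟨k, rfl⟩ : ∃ k : ℕ, d = ((k + 1 : ℕ) : ℤ) := ⟨d.toNat - 1, by omega⟩
  simp only [hInt, Int.natCast_nonneg, if_true, Int.toNat_natCast]
  exact hL_succ_nil k

lemma hInt_perm {L L' : List R} (h : L.Perm L') (d : ℤ) : hInt d L = hInt d L' := by
  simp only [hInt, hL_perm h]

lemma hInt_cons (d : ℤ) (a : R) (L : List R) :
    hInt d (a :: L) = hInt d L + a * hInt (d - 1) (a :: L) := by
  rcases lt_trichotomy d 0 with hd | rfl | hd
  · simp [hInt_of_neg hd, hInt_of_neg (show d - 1 < 0 by omega)]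
  · simp [hInt_zero, hInt_of_neg]
  · obtain ⟨k, rfl⟩ : ∃ k : ℕ, d = ((k + 1 : ℕ) : ℤ) := ⟨d.toNat - 1, by omega⟩
    have h : ((k + 1 : ℕ) : ℤ) - 1 = (k : ℤ) := by omega
    simp only [h, hInt, Int.natCast_nonneg, if_true, Int.toNat_natCast]
    exact hL_succ_cons k a L

/-- The complete homogeneous polynomial `h_d(x 1, …, x n, t 1, …, t i)`. -/
def hXT (x t : ℕ → R) (n i : ℕ) (d : ℤ) : R :=
  hInt d (((List.range n).map fun k => x (k + 1)) ++ ((List.range i).map fun k => t (k + 1)))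

lemma hXT_of_neg (x t : ℕ → R) (n i : ℕ) {d : ℤ} (hd : d < 0) : hXT x t n i d = 0 :=
  hInt_of_neg hd _

lemma hXT_succ_right (x t : ℕ → R) (n i : ℕ) (d : ℤ) :
    hXT x t n (i + 1) d = hXT x t n i d + t (i + 1) * hXT x t n (i + 1) (d - 1) := by
  have h : (((List.range n).map fun k => x (k + 1)) ++
      ((List.range (i + 1)).map fun k => t (k + 1))).Perm
      (t (i + 1) :: (((List.range n).map fun k => x (k + 1)) ++
      ((List.range i).map fun k => t (k + 1)))) := by
    rw [List.range_succ, List.map_append, ← List.append_assoc]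
    exact List.perm_append_singleton _ _
  simp only [hXT]
  rw [hInt_perm h, hInt_perm h, hInt_cons]

lemma hXT_succ_left (x t : ℕ → R) (n i : ℕ) (d : ℤ) :
    hXT x t (n + 1) i d = hXT x t n i d + x (n + 1) * hXT x t (n + 1) i (d - 1) := by
  have h : (((List.range (n + 1)).map fun k => x (k + 1)) ++
      ((List.range i).map fun k => t (k + 1))).Perm
      (x (n + 1) :: (((List.range n).map fun k => x (k + 1)) ++
      ((List.range i).map fun k => t (k + 1)))) := by
    rw [List.range_succ, List.map_append, List.append_assoc]
    exact List.perm_middle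
  simp only [hXT]
  rw [hInt_perm h, hInt_perm h, hInt_cons]

lemma hXT_exchange (x t : ℕ → R) (n i : ℕ) (d : ℤ) :
    hXT x t n (i + 1) d =
      hXT x t (n + 1) i d + (t (i + 1) - x (n + 1)) * hXT x t (n + 1) (i + 1) (d - 1) := by
  linear_combination hXT_succ_right x t (n + 1) i d - hXT_succ_left x t n (i + 1) d

lemma sum_pow_mul_hXT (x t : ℕ → R) (n i : ℕ) {e : ℤ} (he : e ≤ 0) (P : ℕ) :
    ∑ p ∈ Finset.range P, t (i + 1) ^ (P - 1 - p) * hXT x t n i (e + p) =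
      hXT x t n (i + 1) (e + P - 1) := by
  induction P with
  | zero => rw [Finset.sum_range_zero, hXT_of_neg x t n (i + 1) (by push_cast; omega)]
  | succ P ih =>
    rw [Finset.sum_range_succ, hXT_succ_right]
    have h₁ : e + ((P + 1 : ℕ) : ℤ) - 1 = e + P := by push_cast; ring
    rw [h₁, ← ih, Finset.mul_sum, add_comm]
    congr 1
    · simp
    · refine Finset.sum_congr rfl fun p hp => ?_
      have h₂ : P + 1 - 1 - p = (P - 1 - p) + 1 := by
        have := Finset.mem_range.1 hp
        omega
      rw [h₂, pow_succ]
      ring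

lemma sum_weight_mul_hXT (x t : ℕ → R) (n i : ℕ) {e : ℤ} (he : e ≤ 0) {A B : ℕ} (h : B ≤ A) :
    ∑ p ∈ Finset.range (A + 1),
        t (i + 1) ^ (B - p) * x (n + 1) ^ (A - max p B) * hXT x t n i (e + p) =
      hXT x t (n + 1) i (e + A) +
        x (n + 1) ^ (A - B) * (t (i + 1) - x (n + 1)) * hXT x t (n + 1) (i + 1) (e + B - 1) := by
  induction A, h using Nat.le_induction with
  | base =>
    have h₁ := sum_pow_mul_hXT x t n i he (B + 1)
    have h₂ : e + ((B + 1 : ℕ) : ℤ) - 1 = e + B := by push_cast; ring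
    rw [h₂, hXT_exchange] at h₁
    simp only [Nat.sub_self, pow_zero, one_mul]
    rw [← h₁]
    refine Finset.sum_congr rfl fun p hp => ?_
    have h₃ : B - max p B = 0 := by omega
    simp [h₃]
  | succ A hA ih =>
    rw [Finset.sum_range_succ, hXT_succ_left]
    have h₁ : e + ((A + 1 : ℕ) : ℤ) - 1 = e + A := by push_cast; ring
    have h₂ : A + 1 - B = (A - B) + 1 := by omega
    have h₃ : B - (A + 1) = 0 := by omega
    have h₄ : A + 1 - max (A + 1) B = 0 := by omega
    rw [h₁, h₂, h₃, h₄, pow_succ]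
    have h₅ : ∑ p ∈ Finset.range (A + 1),
        t (i + 1) ^ (B - p) * x (n + 1) ^ (A + 1 - max p B) * hXT x t n i (e + p) =
        x (n + 1) * ∑ p ∈ Finset.range (A + 1),
        t (i + 1) ^ (B - p) * x (n + 1) ^ (A - max p B) * hXT x t n i (e + p) := by
      rw [Finset.mul_sum]
      refine Finset.sum_congr rfl fun p hp => ?_
      have h₆ : A + 1 - max p B = (A - max p B) + 1 := by
        have := Finset.mem_range.1 hp
        omega
      rw [h₆, pow_succ]
      ring
    rw [h₅, ih]
    ring

lemma sum_weight_mul_hXT_of_le (x t : ℕ → R) (n i : ℕ) {e : ℤ} (he : e ≤ 0) {A B q : ℕ}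
    (hq : q ≤ B) :
    ∑ p ∈ Finset.range q,
        t (i + 1) ^ (B - p) * x (n + 1) ^ (A - max p B) * hXT x t n i (e + p) =
      t (i + 1) ^ (B - q + 1) * x (n + 1) ^ (A - B) * hXT x t n (i + 1) (e + q - 1) := by
  rw [← sum_pow_mul_hXT x t n i he q, Finset.mul_sum]
  refine Finset.sum_congr rfl fun p hp => ?_
  have hp := Finset.mem_range.1 hp
  have h₁ : B - p = (B - q + 1) + (q - 1 - p) := by omega
  rw [max_eq_right (by omega), h₁, pow_add]
  ring

/-- The entry of `μ` following position `i`, with the convention that it is `c` at the end. -/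
def nextEntry {ℓ : ℕ} (c : ℕ) (μ : Fin ℓ → ℕ) (i : Fin ℓ) : ℕ :=
  if h : (i : ℕ) + 1 < ℓ then μ ⟨(i : ℕ) + 1, h⟩ else c

lemma nextEntry_update_of_le {ℓ : ℕ} (c : ℕ) (μ : Fin ℓ → ℕ) {s i : Fin ℓ} (h : s ≤ i) (p : ℕ) :
    nextEntry c (Function.update μ s p) i = nextEntry c μ i := by
  unfold nextEntry
  split_ifs with hi
  · refine Function.update_of_ne (fun he => ?_) _ _
    have := congrArg Fin.val he
    simp only [Fin.le_def] at h this
    omega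
  · rfl

lemma prod_mul_det_update {ℓ : ℕ} (w : Fin ℓ → ℕ → R) (H : Fin ℓ → ℕ → Fin ℓ → R)
    (μ : Fin ℓ → ℕ) (s : Fin ℓ) (p : ℕ) :
    (∏ i, w i (Function.update μ s p i)) *
        Matrix.det (Matrix.of fun i => H i (Function.update μ s p i)) =
      (∏ i ∈ Finset.univ.erase s, w i (μ i)) *
        Matrix.detRowAlternating (Function.update (fun i => H i (μ i)) s (w s p • H s p)) := by
  have h₁ : (fun i => H i (Function.update μ s p i)) =
      Function.update (fun i => H i (μ i)) s (H s p) := by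
    funext i
    by_cases hi : i = s
    · subst hi; simp
    · simp [hi]
  have h₂ : ∏ i ∈ Finset.univ.erase s, w i (Function.update μ s p i) =
      ∏ i ∈ Finset.univ.erase s, w i (μ i) :=
    Finset.prod_congr rfl fun i hi => by
      rw [Function.update_of_ne (Finset.ne_of_mem_erase hi)]
  rw [← Finset.mul_prod_erase _ _ (Finset.mem_univ s), h₂, Function.update_self, h₁,
    AlternatingMap.map_update_smul, smul_eq_mul]
  change _ * Matrix.detRowAlternating _ = _
  rw [mul_comm (w s p), mul_assoc]
  rfl

/-- If the partial row sums `∑ p < q, w s p • H s p` are multiples of the row `H (s + 1) q`, then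
restricting a weighted sum of determinants to the weakly decreasing sequences does not change it. -/
lemma sum_filter_chain_det {ℓ : ℕ} (c : ℕ) (U : Fin ℓ → ℕ) (w : Fin ℓ → ℕ → R)
    (H : Fin ℓ → ℕ → Fin ℓ → R)
    (hlast : ∀ s : Fin ℓ, ¬ (s : ℕ) + 1 < ℓ →
      c ≤ U s ∧ ∑ p ∈ Finset.range c, w s p • H s p = 0)
    (hnext : ∀ (s : Fin ℓ) (h : (s : ℕ) + 1 < ℓ), U ⟨(s : ℕ) + 1, h⟩ ≤ U s ∧
      ∀ q ≤ U ⟨(s : ℕ) + 1, h⟩, ∃ k : R,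
        ∑ p ∈ Finset.range q, w s p • H s p = k • H ⟨(s : ℕ) + 1, h⟩ q) :
    ∑ μ ∈ (Fintype.piFinset fun i => Finset.range (U i + 1)).filter
        (fun μ => ∀ i, nextEntry c μ i ≤ μ i),
        (∏ i, w i (μ i)) * Matrix.det (Matrix.of fun i => H i (μ i)) =
      Matrix.det (Matrix.of fun i => ∑ p ∈ Finset.range (U i + 1), w i p • H i p) := by
  have hbad : ∀ s : Fin ℓ,
      ∑ μ ∈ (Fintype.piFinset fun i => Finset.range (U i + 1)).filter
        (fun μ => (∀ i, s < i → nextEntry c μ i ≤ μ i) ∧ μ s < nextEntry c μ s),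
        (∏ i, w i (μ i)) * Matrix.det (Matrix.of fun i => H i (μ i)) = 0 := by
    intro s
    set V := (Fintype.piFinset fun i => Finset.range (U i + 1)).filter
        (fun μ => (∀ i, s < i → nextEntry c μ i ≤ μ i) ∧ μ s < nextEntry c μ s) with hV
    rw [← Finset.sum_fiberwise_of_maps_to (s := V)
      (t := V.image fun μ => Function.update μ s 0) (g := fun μ => Function.update μ s 0)
      (fun μ hμ => Finset.mem_image_of_mem _ hμ)]
    refine Finset.sum_eq_zero fun ν hν => ?_
    obtain ⟨μ, hμ, rfl⟩ := Finset.mem_image.1 hν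
    simp only [hV, Finset.mem_filter, Fintype.mem_piFinset, Finset.mem_range] at hμ
    obtain ⟨hμU, hμs, -⟩ := hμ
    have hqU : nextEntry c μ s ≤ U s := by
      unfold nextEntry
      split_ifs with h
      · exact (Nat.lt_succ_iff.1 (hμU _)).trans (hnext s h).1
      · exact (hlast s h).1
    have hfib : V.filter (fun κ => Function.update κ s 0 = Function.update μ s 0) =
        (Finset.range (nextEntry c μ s)).image fun p => Function.update μ s p := by
      ext κ
      simp only [hV, Finset.mem_filter, Fintype.mem_piFinset, Finset.mem_range, Finset.mem_image]
      constructor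
      · rintro ⟨⟨-, -, hκ⟩, he⟩
        have hκμ : Function.update μ s (κ s) = κ := by
          have := congrArg (fun f => Function.update f s (κ s)) he
          simpa using this.symm
        refine ⟨κ s, ?_, hκμ⟩
        rwa [← hκμ, nextEntry_update_of_le c μ le_rfl, hκμ] at hκ
      · rintro ⟨p, hp, rfl⟩
        refine ⟨⟨fun i => ?_, fun i hi => ?_, ?_⟩, by simp⟩
        · by_cases hi : i = s
          · subst hi
            rw [Function.update_self]
            omega
          · rw [Function.update_of_ne hi]
            exact hμU i
        · rw [nextEntry_update_of_le c μ hi.le, Function.update_of_ne hi.ne']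
          exact hμs i hi
        · rwa [nextEntry_update_of_le c μ le_rfl, Function.update_self]
    rw [hfib, Finset.sum_image fun p _ p' _ h => Function.update_injective μ s h]
    simp only [prod_mul_det_update]
    rw [← Finset.mul_sum, ← AlternatingMap.map_update_sum]
    refine mul_eq_zero_of_right _ ?_
    by_cases h : (s : ℕ) + 1 < ℓ
    · have hq : nextEntry c μ s = μ ⟨(s : ℕ) + 1, h⟩ := dif_pos h
      obtain ⟨k, hk⟩ := (hnext s h).2 (μ ⟨(s : ℕ) + 1, h⟩) (Nat.lt_succ_iff.1 (hμU _))
      have hne : (⟨(s : ℕ) + 1, h⟩ : Fin ℓ) ≠ s := fun he => by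
        have := congrArg Fin.val he
        simp at this
      rw [hq, hk, AlternatingMap.map_update_smul]
      rw [AlternatingMap.map_update_self _ (fun i => H i (μ i)) hne.symm, smul_zero]
    · have hq : nextEntry c μ s = c := dif_neg h
      rw [hq, (hlast s h).2]
      exact AlternatingMap.map_update_zero _ _ _
  have hstep : ∀ k : ℕ, k ≤ ℓ →
      ∑ μ ∈ (Fintype.piFinset fun i => Finset.range (U i + 1)).filter
        (fun μ => ∀ i : Fin ℓ, k ≤ i → nextEntry c μ i ≤ μ i),
        (∏ i, w i (μ i)) * Matrix.det (Matrix.of fun i => H i (μ i)) =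
      Matrix.det (Matrix.of fun i => ∑ p ∈ Finset.range (U i + 1), w i p • H i p) := by
    intro k hk
    induction hk using Nat.decreasingInduction with
    | self =>
      rw [Finset.filter_true_of_mem fun μ _ i hi => absurd i.2 (not_lt.2 hi)]
      change _ = Matrix.detRowAlternating.toMultilinearMap
        (fun i => ∑ p ∈ Finset.range (U i + 1), w i p • H i p)
      rw [MultilinearMap.map_sum_finset]
      refine Finset.sum_congr rfl fun μ _ => ?_
      rw [MultilinearMap.map_smul_univ]
      rfl
    | of_succ k hk ih =>
      rw [← ih, ← Finset.sum_filter_add_sum_filter_not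
        ((Fintype.piFinset fun i => Finset.range (U i + 1)).filter
        (fun μ => ∀ i : Fin ℓ, k + 1 ≤ i → nextEntry c μ i ≤ μ i))
        (fun μ => nextEntry c μ ⟨k, hk⟩ ≤ μ ⟨k, hk⟩), Finset.filter_filter, Finset.filter_filter]
      have hz := hbad ⟨k, hk⟩
      have h₁ : ∀ μ : Fin ℓ → ℕ, (∀ i : Fin ℓ, k ≤ i → nextEntry c μ i ≤ μ i) ↔
          (∀ i : Fin ℓ, k + 1 ≤ i → nextEntry c μ i ≤ μ i) ∧
            nextEntry c μ ⟨k, hk⟩ ≤ μ ⟨k, hk⟩ := by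
        refine fun μ => ⟨fun h => ⟨fun i hi => h i (by omega), h _ le_rfl⟩, fun h i hi => ?_⟩
        rcases hi.eq_or_lt with he | hlt
        · have : i = ⟨k, hk⟩ := Fin.ext he.symm
          rw [this]
          exact h.2
        · exact h.1 i hlt
      simp only [Fin.lt_def, ← Nat.succ_le_iff, Nat.succ_eq_add_one] at hz
      simp only [h₁, not_le, ← Nat.succ_le_iff, Nat.succ_eq_add_one]
      rw [hz, add_zero]
  simpa using hstep 0 (Nat.zero_le _)

/-- Adding to each row a multiple of the next row of the same matrix preserves the determinant. -/
lemma det_add_mul_next_row {ℓ : ℕ} (G : Matrix (Fin ℓ) (Fin ℓ) R) (a : Fin ℓ → R) :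
    Matrix.det (Matrix.of fun i j : Fin ℓ =>
      G i j + if h : (i : ℕ) + 1 < ℓ then a i * G ⟨(i : ℕ) + 1, h⟩ j else 0) = G.det := by
  set M : Matrix (Fin ℓ) (Fin ℓ) R :=
    Matrix.of fun i k => (if k = i then 1 else 0) + (if (k : ℕ) = i + 1 then a i else 0) with hM
  have hdet : M.det = 1 := by
    rw [Matrix.det_of_isUpperTriangular]
    · simp [hM]
    · intro i k hki
      have h₁ : (k : ℕ) < i := hki
      have h₂ : k ≠ i := fun h => by rw [h] at h₁; omega
      have h₃ : (k : ℕ) ≠ i + 1 := by omega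
      simp [hM, h₂, h₃]
  have hmul : (Matrix.of fun i j : Fin ℓ =>
      G i j + if h : (i : ℕ) + 1 < ℓ then a i * G ⟨(i : ℕ) + 1, h⟩ j else 0) = M * G := by
    ext i j
    simp only [Matrix.mul_apply, hM, Matrix.of_apply, add_mul, Finset.sum_add_distrib, ite_mul,
      one_mul, zero_mul, Finset.sum_ite_eq', Finset.mem_univ, if_true]
    congr 1
    split_ifs with h
    · rw [Finset.sum_eq_single (⟨(i : ℕ) + 1, h⟩ : Fin ℓ)]
      · simp
      · intro k _ hk
        exact if_neg fun he => hk (Fin.ext he)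
      · simp
    · symm
      exact Finset.sum_eq_zero fun k _ => if_neg (by have := k.2; omega)
  rw [hmul, Matrix.det_mul, hdet, one_mul]

lemma nextEntry_add {ℓ : ℕ} (c d : ℕ) (μ : Fin ℓ → ℕ) (i : Fin ℓ) :
    nextEntry (c + d) (fun k => μ k + d) i = nextEntry c μ i + d := by
  unfold nextEntry
  split_ifs <;> rfl

lemma le_of_nextEntry_le {ℓ c : ℕ} {μ : Fin ℓ → ℕ} (h : ∀ i, nextEntry c μ i ≤ μ i) (i : Fin ℓ) :
    c ≤ μ i := by
  have key : ∀ (k : ℕ), k ≤ ℓ → ∀ (hk : k < ℓ), c ≤ μ ⟨k, hk⟩ := by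
    intro k hk
    induction hk using Nat.decreasingInduction with
    | self => exact fun hk => absurd hk (lt_irrefl _)
    | of_succ k hk ih =>
      intro hk'
      refine le_trans ?_ (h ⟨k, hk'⟩)
      unfold nextEntry
      split_ifs with hs
      · exact ih hs
      · exact le_rfl
  exact key i i.2.le i.2

/-- The weighted sum over shapes contained in `lam` of the Jacobi–Trudi determinants in `n`
variables `x` is the Jacobi–Trudi determinant in `n + 1` variables `x`. -/
lemma sum_weight_mul_det (ℓ n : ℕ) (lam : Fin ℓ → ℕ) (hlam : ∀ i, nextEntry 0 lam i ≤ lam i)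
    (x t : ℕ → R) :
    ∑ μ ∈ (Fintype.piFinset fun i => Finset.range (lam i + 1)).filter
        (fun μ => ∀ i, nextEntry 0 μ i ≤ μ i),
        (∏ i : Fin ℓ, t (i + 1) ^ (nextEntry 0 lam i - μ i) *
            x (n + 1) ^ (lam i - max (μ i) (nextEntry 0 lam i))) *
          Matrix.det (Matrix.of fun i j : Fin ℓ => hXT x t n i ((μ i : ℤ) + j - i)) =
      Matrix.det (Matrix.of fun i j : Fin ℓ => hXT x t (n + 1) i ((lam i : ℤ) + j - i)) := by
  have hchain := sum_filter_chain_det ℓ (fun i => lam i + ℓ)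
    (fun i p => t (i + 1) ^ (nextEntry 0 lam i + ℓ - p) *
      x (n + 1) ^ (lam i + ℓ - max p (nextEntry 0 lam i + ℓ)))
    (fun i p j => hXT x t n i ((j : ℤ) - i - ℓ + p)) ?_ ?_
  · have hshift : ∀ μ : Fin ℓ → ℕ, (∀ i, nextEntry ℓ (fun k => μ k + ℓ) i ≤ μ i + ℓ) ↔
        ∀ i, nextEntry 0 μ i ≤ μ i := fun μ => by
      have h := nextEntry_add 0 ℓ μ
      rw [zero_add] at h
      simp only [h, add_le_add_iff_right]
    trans Matrix.det (Matrix.of fun i : Fin ℓ => ∑ p ∈ Finset.range (lam i + ℓ + 1),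
      (t (i + 1) ^ (nextEntry 0 lam i + ℓ - p) *
      x (n + 1) ^ (lam i + ℓ - max p (nextEntry 0 lam i + ℓ))) •
      (fun j : Fin ℓ => hXT x t n i ((j : ℤ) - i - ℓ + p)))
    · rw [← hchain]
      refine Finset.sum_bij (fun μ _ i => μ i + ℓ) ?_ ?_ ?_ ?_
      · intro μ hμ
        simp only [Finset.mem_filter, Fintype.mem_piFinset, Finset.mem_range] at hμ ⊢
        exact ⟨fun i => by have := hμ.1 i; omega, (hshift μ).2 hμ.2⟩
      · intro μ _ κ _ h
        funext i
        exact Nat.add_right_cancel (congrFun h i)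
      · intro κ hκ
        simp only [Finset.mem_filter, Fintype.mem_piFinset, Finset.mem_range] at hκ
        have hle := le_of_nextEntry_le hκ.2
        have heq : (fun i => κ i - ℓ + ℓ) = κ := funext fun i => Nat.sub_add_cancel (hle i)
        refine ⟨fun i => κ i - ℓ, ?_, heq⟩
        simp only [Finset.mem_filter, Fintype.mem_piFinset, Finset.mem_range]
        refine ⟨fun i => by have := hκ.1 i; have := hle i; omega, (hshift _).1 ?_⟩
        have := hκ.2
        rw [← heq] at this
        exact this
      · intro μ _
        congr 1
        · refine Finset.prod_congr rfl fun i _ => ?_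
          have hmax : lam i - max (μ i) (nextEntry 0 lam i) =
              lam i + ℓ - max (μ i + ℓ) (nextEntry 0 lam i + ℓ) := by omega
          rw [Nat.add_sub_add_right, hmax]
        · congr 1
          ext i j
          simp only [Matrix.of_apply]
          congr 1
          push_cast
          ring
    · rw [← det_add_mul_next_row (Matrix.of fun i j : Fin ℓ =>
        hXT x t (n + 1) i ((lam i : ℤ) + j - i))
        (fun i => x (n + 1) ^ (lam i - nextEntry 0 lam i) * (t (i + 1) - x (n + 1)))]
      congr 1
      ext i j
      have hj := j.2
      simp only [Matrix.of_apply, Finset.sum_apply, Pi.smul_apply, smul_eq_mul]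
      rw [sum_weight_mul_hXT x t n i (by omega) (Nat.add_le_add_right (hlam i) ℓ)]
      congr 1
      · congr 1
        push_cast
        ring
      · rw [Nat.add_sub_add_right]
        split_ifs with h
        · have h₁ : nextEntry 0 lam i = lam ⟨(i : ℕ) + 1, h⟩ := dif_pos h
          rw [h₁]
          congr 2
          push_cast
          ring
        · have h₁ : nextEntry 0 lam i = 0 := dif_neg h
          rw [h₁, hXT_of_neg _ _ _ _ (by push_cast; omega), mul_zero]
  · intro s h
    refine ⟨Nat.le_add_left _ _, funext fun j => ?_⟩
    have hj := j.2
    simp only [Finset.sum_apply, Pi.smul_apply, smul_eq_mul, Pi.zero_apply]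
    rw [sum_weight_mul_hXT_of_le x t n s (by omega) (Nat.le_add_left _ _),
      hXT_of_neg _ _ _ _ (by omega), mul_zero]
  · intro s h
    have h₁ : nextEntry 0 lam s = lam ⟨(s : ℕ) + 1, h⟩ := dif_pos h
    refine ⟨Nat.add_le_add_right (h₁ ▸ hlam s) ℓ, fun q hq => ?_⟩
    refine ⟨t (s + 1) ^ (nextEntry 0 lam s + ℓ - q + 1) *
      x (n + 1) ^ (lam s + ℓ - (nextEntry 0 lam s + ℓ)), funext fun j => ?_⟩
    have hj := j.2
    simp only [Finset.sum_apply, Pi.smul_apply, smul_eq_mul]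
    rw [sum_weight_mul_hXT_of_le x t n s (by omega) (h₁ ▸ hq)]
    congr 2
    push_cast
    ring

lemma extendFin_val {ℓ : ℕ} (μ : Fin ℓ → ℕ) (r : Fin ℓ) : extendFin ℓ μ r.1 = μ r := dif_pos r.2

lemma extendFin_succ {ℓ : ℕ} (μ : Fin ℓ → ℕ) (r : Fin ℓ) :
    extendFin ℓ μ (r.1 + 1) = nextEntry 0 μ r := rfl

lemma extendFin_antitone {ℓ : ℕ} {μ : Fin ℓ → ℕ} (h : ∀ i, nextEntry 0 μ i ≤ μ i) :
    Antitone (extendFin ℓ μ) := by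
  refine antitone_nat_of_succ_le fun r => ?_
  by_cases hr : r < ℓ
  · have := h ⟨r, hr⟩
    rwa [← extendFin_succ, ← extendFin_val μ ⟨r, hr⟩] at this
  · have h₁ : extendFin ℓ μ (r + 1) = 0 := dif_neg (by omega)
    rw [h₁]
    exact Nat.zero_le _

/-- Fill the boxes of `lam` outside `κ` with the new largest entry. -/
def extendRPP {ℓ n : ℕ} (lam : ℕ → ℕ) {κ : ℕ → ℕ} (T : YBox ℓ κ → Fin (n + 1)) :
    YBox ℓ lam → Fin (n + 1 + 1) :=
  fun b => if h : (b.2 : ℕ) < κ b.1.1 then (T ⟨b.1, ⟨b.2, h⟩⟩).castSucc else Fin.last (n + 1)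

lemma extendRPP_of_lt {ℓ n : ℕ} {lam κ : ℕ → ℕ} (T : YBox ℓ κ → Fin (n + 1)) {r : Fin ℓ}
    {c : Fin (lam r.1)} (h : (c : ℕ) < κ r.1) :
    extendRPP lam T ⟨r, c⟩ = (T ⟨r, ⟨c, h⟩⟩).castSucc := dif_pos h

lemma extendRPP_of_le {ℓ n : ℕ} {lam κ : ℕ → ℕ} (T : YBox ℓ κ → Fin (n + 1)) {r : Fin ℓ}
    {c : Fin (lam r.1)} (h : κ r.1 ≤ (c : ℕ)) :
    extendRPP lam T ⟨r, c⟩ = Fin.last (n + 1) := dif_neg (not_lt.2 h)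

lemma extendRPP_eq_last_iff {ℓ n : ℕ} {lam κ : ℕ → ℕ} (T : YBox ℓ κ → Fin (n + 1)) {r : Fin ℓ}
    {c : Fin (lam r.1)} : extendRPP lam T ⟨r, c⟩ = Fin.last (n + 1) ↔ κ r.1 ≤ (c : ℕ) := by
  refine ⟨fun h => ?_, extendRPP_of_le T⟩
  by_contra! hc
  rw [extendRPP_of_lt T hc] at h
  exact (Fin.castSucc_lt_last _).ne h

lemma isSkewRPP_extendRPP {ℓ n : ℕ} (lam : ℕ → ℕ) {κ : ℕ → ℕ} (hκ : Antitone κ)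
    {T : YBox ℓ κ → Fin (n + 1)} (hT : IsSkewRPP ℓ n κ (fun _ => 0) T) :
    IsSkewRPP ℓ (n + 1) lam (fun _ => 0) (extendRPP lam T) := by
  obtain ⟨h₀, hrow, hcol⟩ := hT
  refine ⟨fun ⟨r, c⟩ => ?_, fun r c c' _ hcc => ?_, fun r r' c c' hr hcc _ _ => ?_⟩
  · refine ⟨fun h => ?_, fun h => absurd h (Nat.not_lt_zero _)⟩
    by_cases hc : (c : ℕ) < κ r.1
    · rw [extendRPP_of_lt T hc] at h
      exact (h₀ _).1 h
    · rw [extendRPP_of_le T (not_lt.1 hc)] at h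
      simp at h
  · by_cases hc : (c' : ℕ) < κ r.1
    · rw [extendRPP_of_lt T hc, extendRPP_of_lt T (hcc.trans_lt hc)]
      exact Fin.castSucc_le_castSucc_iff.2 (hrow r _ _ (Nat.zero_le _) hcc)
    · rw [extendRPP_of_le T (not_lt.1 hc)]
      exact Fin.le_last _
  · by_cases hc : (c' : ℕ) < κ r'.1
    · rw [extendRPP_of_lt T hc, extendRPP_of_lt T (hcc ▸ hc.trans_le (hκ hr))]
      exact Fin.castSucc_le_castSucc_iff.2 (hcol r r' _ _ hr hcc (Nat.zero_le _) (Nat.zero_le _))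
    · rw [extendRPP_of_le T (not_lt.1 hc)]
      exact Fin.le_last _

lemma prod_fin_split {L M B : ℕ} (hM : M ≤ L) (hB : B ≤ L) (a b : R) (F : Fin L → R)
    (G : Fin M → R) (hG : ∀ c : Fin M, F (Fin.castLE hM c) = G c)
    (hF : ∀ c : Fin L, M ≤ (c : ℕ) → F c = if (c : ℕ) < B then a else b) :
    ∏ c, F c = a ^ (B - M) * b ^ (L - max M B) * ∏ c, G c := by
  obtain ⟨k, rfl⟩ := Nat.exists_eq_add_of_le hM
  have h : ∀ k : ℕ, ∏ c ∈ Finset.range k, (if M + c < B then a else b) =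
      a ^ (min (B - M) k) * b ^ (k - (B - M)) := by
    intro k
    induction k with
    | zero => simp
    | succ k ih =>
      rw [Finset.prod_range_succ, ih]
      split_ifs with hk
      · rw [min_eq_right (by omega), min_eq_right (by omega), Nat.sub_eq_zero_of_le (by omega),
          Nat.sub_eq_zero_of_le (by omega)]
        ring
      · rw [min_eq_left (by omega), min_eq_left (by omega), Nat.sub_add_comm (by omega)]
        ring
  rw [Fin.prod_univ_add, mul_comm]
  congr 1
  · rw [Finset.prod_congr rfl fun c _ => hF (Fin.natAdd M c) (by simp)]
    simp only [Fin.val_natAdd]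
    rw [Fin.prod_univ_eq_prod_range (fun c => if M + c < B then a else b) k, h,
      min_eq_left (by omega)]
    congr 2
    omega
  · exact Finset.prod_congr rfl fun c _ => hG c

lemma prod_boxWeight_extendRPP {ℓ n : ℕ} {lam κ : ℕ → ℕ} (hκ : Antitone κ)
    (hlam : ∀ r : Fin ℓ, nextEntry 0 (fun i : Fin ℓ => lam i) r ≤ lam r)
    (hle : ∀ r : Fin ℓ, κ r ≤ lam r) (x t : ℕ → R) (T : YBox ℓ κ → Fin (n + 1)) :
    ∏ b, boxWeight ℓ (n + 1) lam (fun _ => 0) x t (extendRPP lam T) b =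
      (∏ r : Fin ℓ, t (r + 1) ^ (nextEntry 0 (fun i : Fin ℓ => lam i) r - κ r) *
        x (n + 1) ^ (lam r - max (κ r) (nextEntry 0 (fun i : Fin ℓ => lam i) r))) *
      ∏ b, boxWeight ℓ n κ (fun _ => 0) x t T b := by
  rw [Fintype.prod_sigma, Fintype.prod_sigma, ← Finset.prod_mul_distrib]
  refine Finset.prod_congr rfl fun r _ => ?_
  refine prod_fin_split (hle r) (hlam r) _ _ _ _ (fun c => ?_) (fun c hc => ?_)
  · simp only [boxWeight, Nat.zero_le, if_true, Fin.val_castLE]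
    have hc : ((Fin.castLE (hle r) c : Fin (lam r)) : ℕ) < κ r := c.2
    have hiff : (∃ (hr : (r : ℕ) + 1 < ℓ) (hc : (c : ℕ) < lam ((r : ℕ) + 1)),
        extendRPP lam T ⟨⟨(r : ℕ) + 1, hr⟩, ⟨(c : ℕ), hc⟩⟩ =
          extendRPP lam T ⟨r, Fin.castLE (hle r) c⟩) ↔
        ∃ (hr : (r : ℕ) + 1 < ℓ) (hc : (c : ℕ) < κ ((r : ℕ) + 1)),
          T ⟨⟨(r : ℕ) + 1, hr⟩, ⟨(c : ℕ), hc⟩⟩ = T ⟨r, c⟩ := by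
      rw [extendRPP_of_lt T hc]
      refine exists_congr fun hr => ⟨?_, ?_⟩
      · rintro ⟨hcl, he⟩
        by_cases hcκ : (c : ℕ) < κ ((r : ℕ) + 1)
        · rw [extendRPP_of_lt T (r := ⟨(r : ℕ) + 1, hr⟩) hcκ] at he
          exact ⟨hcκ, Fin.castSucc_injective _ he⟩
        · rw [extendRPP_of_le T (r := ⟨(r : ℕ) + 1, hr⟩) (not_lt.1 hcκ)] at he
          exact absurd he.symm (Fin.castSucc_lt_last _).ne
      · rintro ⟨hcκ, he⟩
        refine ⟨hcκ.trans_le (hle ⟨(r : ℕ) + 1, hr⟩), ?_⟩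
        rw [extendRPP_of_lt T (r := ⟨(r : ℕ) + 1, hr⟩) hcκ, he]
        rfl
    rw [extendRPP_of_lt T hc] at hiff ⊢
    simp only [hiff]
    rfl
  · simp only [boxWeight, Nat.zero_le, if_true]
    rw [extendRPP_of_le T hc, Fin.val_last]
    refine if_congr ⟨?_, fun h => ?_⟩ rfl rfl
    · rintro ⟨hr, hcl, -⟩
      have h : nextEntry 0 (fun i : Fin ℓ => lam i) r = lam ((r : ℕ) + 1) := dif_pos hr
      rwa [h]
    · unfold nextEntry at h
      split_ifs at h with hr
      · exact ⟨hr, h, extendRPP_of_le T ((hκ (Nat.le_succ _)).trans hc)⟩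
      · exact absurd h (Nat.not_lt_zero _)

lemma exists_forall_iff_lt {L : ℕ} (P : Fin L → Prop) (hP : ∀ c c', c ≤ c' → P c' → P c) :
    ∃ m ≤ L, ∀ c : Fin L, P c ↔ (c : ℕ) < m := by
  have hex : ∃ m, ∀ h : m < L, ¬ P ⟨m, h⟩ := ⟨L, fun h => absurd h (lt_irrefl _)⟩
  refine ⟨Nat.find hex, Nat.find_min' hex fun h => absurd h (lt_irrefl _), fun c => ⟨fun hc => ?_,
    fun hc => ?_⟩⟩
  · by_contra! hm
    exact Nat.find_spec hex (hm.trans_lt c.2) (hP _ _ hm hc)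
  · have := Nat.find_min hex hc
    push Not at this
    exact this.2

lemma exists_extendRPP_eq {ℓ n : ℕ} {lam : ℕ → ℕ}
    (hlam : ∀ r : Fin ℓ, nextEntry 0 (fun i : Fin ℓ => lam i) r ≤ lam r)
    {T : YBox ℓ lam → Fin (n + 1 + 1)} (hT : IsSkewRPP ℓ (n + 1) lam (fun _ => 0) T) :
    ∃ μ : Fin ℓ → ℕ, (∀ r, μ r ≤ lam r) ∧ (∀ r, nextEntry 0 μ r ≤ μ r) ∧
      ∃ T' : YBox ℓ (extendFin ℓ μ) → Fin (n + 1),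
        IsSkewRPP ℓ n (extendFin ℓ μ) (fun _ => 0) T' ∧ extendRPP lam T' = T := by
  obtain ⟨h₀, hrow, hcol⟩ := hT
  choose μ hμle hμ using fun r : Fin ℓ =>
    exists_forall_iff_lt (fun c : Fin (lam r) => T ⟨r, c⟩ < Fin.last (n + 1))
      (fun c c' hcc hc' => (hrow r c c' (Nat.zero_le _) hcc).trans_lt hc')
  have hval : ∀ b : YBox ℓ (extendFin ℓ μ), (b.2 : ℕ) < μ b.1 := fun b =>
    b.2.2.trans_eq (extendFin_val μ b.1)
  have hin : ∀ b : YBox ℓ (extendFin ℓ μ), (b.2 : ℕ) < lam b.1.1 := fun b =>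
    (hval b).trans_le (hμle _)
  have hlt : ∀ b : YBox ℓ (extendFin ℓ μ), T ⟨b.1, ⟨b.2, hin b⟩⟩ < Fin.last (n + 1) := fun b =>
    (hμ b.1 ⟨b.2, hin b⟩).2 (hval b)
  refine ⟨μ, hμle, fun r => ?_, fun b => (T ⟨b.1, ⟨b.2, hin b⟩⟩).castLT (hlt b),
    ⟨fun b => h₀ ⟨b.1, ⟨b.2, hin b⟩⟩, fun r c c' _ hcc => ?_, fun r r' c c' hr hcc _ _ => ?_⟩, ?_⟩
  · have hl := hlam r
    unfold nextEntry at hl ⊢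
    split_ifs at hl ⊢ with hr
    · by_contra! hc
      have h₁ : μ r < lam ((r : ℕ) + 1) := hc.trans_le (hμle ⟨(r : ℕ) + 1, hr⟩)
      have h₂ : T ⟨⟨(r : ℕ) + 1, hr⟩, ⟨μ r, h₁⟩⟩ < Fin.last (n + 1) :=
        (hμ ⟨(r : ℕ) + 1, hr⟩ ⟨μ r, h₁⟩).2 hc
      have h₃ := (hcol r ⟨(r : ℕ) + 1, hr⟩ ⟨μ r, h₁.trans_le hl⟩ ⟨μ r, h₁⟩ (Nat.le_succ _) rfl
        (Nat.zero_le _) (Nat.zero_le _)).trans_lt h₂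
      exact lt_irrefl _ ((hμ r ⟨μ r, h₁.trans_le hl⟩).1 h₃)
    · exact Nat.zero_le _
  · exact hrow r ⟨c, hin ⟨r, c⟩⟩ ⟨c', hin ⟨r, c'⟩⟩ (Nat.zero_le _) hcc
  · exact hcol r r' ⟨c, hin ⟨r, c⟩⟩ ⟨c', hin ⟨r', c'⟩⟩ hr hcc (Nat.zero_le _) (Nat.zero_le _)
  · funext ⟨r, c⟩
    by_cases hc : (c : ℕ) < extendFin ℓ μ r.1
    · rw [extendRPP_of_lt _ hc]
      rfl
    · rw [extendRPP_of_le _ (not_lt.1 hc)]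
      rw [extendFin_val, ← hμ r c, not_lt, Fin.last_le_iff] at hc
      exact hc.symm

lemma extendRPP_shape_le {ℓ n : ℕ} {lam κ κ' : ℕ → ℕ} {T : YBox ℓ κ → Fin (n + 1)}
    {T' : YBox ℓ κ' → Fin (n + 1)} (h : extendRPP lam T = extendRPP lam T') {r : Fin ℓ}
    (hr : κ' r ≤ lam r) : κ' r ≤ κ r := by
  by_contra! hc
  have h₁ := (extendRPP_eq_last_iff T (r := r) (c := ⟨κ r, hc.trans_le hr⟩)).2 le_rfl
  rw [h, extendRPP_eq_last_iff] at h₁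
  exact absurd hc (not_lt.2 h₁)

lemma extendRPP_injective {ℓ n : ℕ} {lam κ : ℕ → ℕ} (hle : ∀ r : Fin ℓ, κ r ≤ lam r) :
    Function.Injective
      (extendRPP lam : (YBox ℓ κ → Fin (n + 1)) → YBox ℓ lam → Fin (n + 1 + 1)) := by
  intro T T' h
  funext ⟨r, c⟩
  have := congrFun h ⟨r, Fin.castLE (hle r) c⟩
  rw [extendRPP_of_lt T (c := Fin.castLE (hle r) c) c.2,
    extendRPP_of_lt T' (c := Fin.castLE (hle r) c) c.2] at this
  exact Fin.castSucc_injective _ this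

lemma dualGroth_succ (ℓ n : ℕ) (lam : ℕ → ℕ)
    (hlam : ∀ r : Fin ℓ, nextEntry 0 (fun i : Fin ℓ => lam i) r ≤ lam r) (x t : ℕ → R) :
    dualGroth ℓ (n + 1) lam (fun _ => 0) x t =
      ∑ μ ∈ (Fintype.piFinset fun i : Fin ℓ => Finset.range (lam i + 1)).filter
        (fun μ => ∀ i, nextEntry 0 μ i ≤ μ i),
        (∏ i : Fin ℓ, t (i + 1) ^ (nextEntry 0 (fun i : Fin ℓ => lam i) i - μ i) *
            x (n + 1) ^ (lam i - max (μ i) (nextEntry 0 (fun i : Fin ℓ => lam i) i))) *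
          dualGroth ℓ n (extendFin ℓ μ) (fun _ => 0) x t := by
  simp only [dualGroth, Finset.mul_sum]
  rw [Finset.sum_sigma']
  symm
  refine Finset.sum_bij (fun p _ => extendRPP lam p.2) ?_ ?_ ?_ ?_
  · rintro ⟨μ, T⟩ hp
    simp only [Finset.mem_sigma, Finset.mem_filter, Finset.mem_univ, true_and] at hp ⊢
    exact isSkewRPP_extendRPP lam (extendFin_antitone hp.1.2) hp.2
  · rintro ⟨μ, T⟩ hp ⟨μ', T'⟩ hp' h
    simp only [Finset.mem_sigma, Finset.mem_filter, Finset.mem_univ, true_and,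
      Fintype.mem_piFinset, Finset.mem_range, Nat.lt_succ_iff] at hp hp'
    have hle : ∀ r : Fin ℓ, extendFin ℓ μ r ≤ lam r := fun r => by
      rw [extendFin_val]; exact hp.1.1 r
    have hle' : ∀ r : Fin ℓ, extendFin ℓ μ' r ≤ lam r := fun r => by
      rw [extendFin_val]; exact hp'.1.1 r
    obtain rfl : μ = μ' := funext fun r => by
      rw [← extendFin_val μ, ← extendFin_val μ']
      exact le_antisymm (extendRPP_shape_le h.symm (hle r)) (extendRPP_shape_le h (hle' r))
    obtain rfl : T = T' := extendRPP_injective hle h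
    rfl
  · intro T hT
    simp only [Finset.mem_filter, Finset.mem_univ, true_and] at hT
    obtain ⟨μ, hle, hμ, T', hT', rfl⟩ := exists_extendRPP_eq hlam hT
    refine ⟨⟨μ, T'⟩, ?_, rfl⟩
    simp only [Finset.mem_sigma, Finset.mem_filter, Finset.mem_univ, true_and,
      Fintype.mem_piFinset, Finset.mem_range, Nat.lt_succ_iff]
    exact ⟨⟨hle, hμ⟩, hT'⟩
  · rintro ⟨μ, T⟩ hp
    simp only [Finset.mem_sigma, Finset.mem_filter, Finset.mem_univ, true_and,
      Fintype.mem_piFinset, Finset.mem_range, Nat.lt_succ_iff] at hp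
    rw [prod_boxWeight_extendRPP (extendFin_antitone hp.1.2) hlam
      (fun r => by rw [extendFin_val]; exact hp.1.1 r)]
    simp only [extendFin_val]

lemma dualGroth_zero (ℓ : ℕ) (lam : ℕ → ℕ)
    (hlam : ∀ r : Fin ℓ, nextEntry 0 (fun i : Fin ℓ => lam i) r ≤ lam r) (x t : ℕ → R) :
    dualGroth ℓ 0 lam (fun _ => 0) x t =
      Matrix.det (Matrix.of fun i j : Fin ℓ => hXT x t 0 i ((lam i : ℤ) + j - i)) := by
  by_cases h : ∀ r : Fin ℓ, lam r = 0
  · have hemp : IsEmpty (YBox ℓ lam) := ⟨fun b => Nat.not_lt_zero _ (b.2.2.trans_eq (h b.1))⟩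
    rw [Matrix.det_of_isUpperTriangular]
    · have hfilter : Finset.univ.filter (IsSkewRPP ℓ 0 lam fun _ => 0) = Finset.univ := by
        refine Finset.filter_true_of_mem fun T _ => ⟨fun b => hemp.elim b,
          fun r c => hemp.elim ⟨r, c⟩, fun r _ c => hemp.elim ⟨r, c⟩⟩
      rw [dualGroth, hfilter]
      simp [h, hXT, hInt_zero]
    · intro i j hji
      have h₁ : (j : ℕ) < i := hji
      rw [Matrix.of_apply, h i, hXT_of_neg _ _ _ _ (by push_cast; omega)]
  · push Not at h
    obtain ⟨r, hr⟩ := h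
    have hanti : Antitone (extendFin ℓ fun i : Fin ℓ => lam i) := extendFin_antitone hlam
    have hℓ : 0 < ℓ := (Nat.zero_le _).trans_lt r.2
    have h₀ : 0 < lam 0 := by
      have h₁ := hanti (Nat.zero_le r.1)
      rw [extendFin_val, show extendFin ℓ (fun i : Fin ℓ => lam i) 0 = lam 0 from dif_pos hℓ] at h₁
      omega
    rw [Matrix.det_eq_zero_of_row_eq_zero ⟨0, hℓ⟩, dualGroth]
    · refine Finset.sum_eq_zero fun T hT => ?_
      have := ((Finset.mem_filter.1 hT).2.1 ⟨⟨0, hℓ⟩, ⟨0, h₀⟩⟩).1 (by omega)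
      exact absurd this (Nat.not_lt_zero _)
    · intro j
      have hpos : 0 < (lam 0 : ℤ) + j - (0 : ℕ) := by omega
      exact hInt_nil_of_pos hpos

lemma dualGroth_eq_det (ℓ n : ℕ) (lam : ℕ → ℕ)
    (hlam : ∀ r : Fin ℓ, nextEntry 0 (fun i : Fin ℓ => lam i) r ≤ lam r) (x t : ℕ → R) :
    dualGroth ℓ n lam (fun _ => 0) x t =
      Matrix.det (Matrix.of fun i j : Fin ℓ => hXT x t n i ((lam i : ℤ) + j - i)) := by
  induction n generalizing lam with
  | zero => exact dualGroth_zero ℓ lam hlam x t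
  | succ n ih =>
    rw [dualGroth_succ ℓ n lam hlam, ← sum_weight_mul_det ℓ n (fun i => lam i) hlam]
    refine Finset.sum_congr rfl fun μ hμ => ?_
    have hμ := (Finset.mem_filter.1 hμ).2
    rw [ih (extendFin ℓ μ)]
    · simp only [extendFin_val]
    · simpa only [extendFin_val] using hμ

/-- **Jacobi–Trudi formula for refined dual Grothendieck polynomials.**
For a partition `λ = (λ_1 ≥ … ≥ λ_ℓ ≥ 0)` (here `lam r` is `λ_{r+1}`),
`g_λ(x_1,…,x_n; t_1,…,t_{ℓ-1})
  = det[ h_{λ_i + j - i}(x_1,…,x_n,t_1,…,t_{i-1}) ]_{i,j=1}^ℓ`. -/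
theorem refined_dual_grothendieck_jacobi_trudi
    {R : Type*} [CommRing R] (ℓ n : ℕ) (lam : ℕ → ℕ)
    (hlam : ∀ i j : ℕ, i ≤ j → j < ℓ → lam j ≤ lam i)
    (x t : ℕ → R) :
    dualGroth ℓ n lam (fun _ => 0) x t =
      Matrix.det (Matrix.of fun i j : Fin ℓ =>
        hInt ((lam i.1 : ℤ) + (j.1 : ℤ) - (i.1 : ℤ))
          (((List.range n).map fun k => x (k + 1)) ++
            ((List.range i.1).map fun k => t (k + 1)))) := by
  refine dualGroth_eq_det ℓ n lam (fun r => ?_) x t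
  unfold nextEntry
  split_ifs with hr
  · exact hlam _ _ (Nat.le_succ _) hr
  · exact Nat.zero_le _

end
end

section
/- Let λ = (λ_1 ≥ … ≥ λ_ℓ ≥ 0) be a partition with at most ℓ parts, let λ' denote its conjugate partition (λ'_i = #{j : λ_j ≥ i}), and let x = (x_1,…,x_n), t = (t_1,…,t_{ℓ−1}). Then the refined dual Grothendieck polynomial satisfies the dual Jacobi–Trudi formula g_λ(x;t) = det[ e_{λ'_i + j − i}(x_1,…,x_n, t_1,…,t_{λ'_i − 1}) ]_{i,j=1}^{λ_1}, where the (i,j) entry is the elementary symmetric polynomial of degree λ'_i + j − i in the variables x_1,…,x_n, t_1,…,t_{λ'_i − 1} (with e_d = 0 for d < 0 and for d larger than the number of variables). -/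
open scoped Classical

noncomputable section

variable {R : Type*} [CommRing R]

/-- The conjugate partition: `conjugate ℓ lam i = λ'_i = #{j ∈ {1,…,ℓ} : λ_j ≥ i}`
(here `lam r` is `λ_{r+1}` and the argument `i` is 1-indexed). -/
def conjugate (ℓ : ℕ) (lam : ℕ → ℕ) (i : ℕ) : ℕ :=
  ((Finset.range ℓ).filter fun r => i ≤ lam r).card

open Finset in
theorem mem_filter_range_card {a : ℕ} {P : ℕ → Prop} [DecidablePred P]
    (hP : ∀ r r', r ≤ r' → r' < a → P r' → P r) (r : ℕ) :
    r < ((range a).filter P).card ↔ r < a ∧ P r := by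
  induction a with
  | zero => simp
  | succ a ih =>
    have ih := ih fun r r' h h' => hP r r' h (by omega)
    rw [range_add_one, filter_insert]
    split_ifs with h
    · have hall : (range a).filter P = range a :=
        filter_true_of_mem fun r hr => hP r a (mem_range.1 hr).le (by omega) h
      rw [card_insert_of_notMem (by simp), hall, card_range]
      exact ⟨fun hr => ⟨hr, hP r a (by omega) (by omega) h⟩, fun hr => hr.1⟩
    · rw [ih]
      refine ⟨fun hr => ⟨by omega, hr.2⟩, fun hr => ⟨?_, hr.2⟩⟩
      rcases Nat.lt_succ_iff_lt_or_eq.1 hr.1 with h' | rfl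
      · exact h'
      · exact absurd hr.2 h

section Expansion

/-- The weight of a column occupying the rows `b, …, a - 1` filled with a single entry of
weight `x`. -/
def stripWeight (x : R) (t : ℕ → R) (b a : ℕ) : R :=
  if b = a then 1 else x * ∏ r ∈ Finset.Ico (b + 1) a, t r

/-- The weakly decreasing sequences dominated entrywise by `α`. -/
def subshapes {p : ℕ} (α : Fin p → ℕ) : Finset (Fin p → ℕ) :=
  (Fintype.piFinset fun i => Finset.range (α i + 1)).filter Antitone

theorem mem_subshapes {p : ℕ} {α β : Fin p → ℕ} :
    β ∈ subshapes α ↔ (∀ i, β i ≤ α i) ∧ Antitone β := by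
  simp [subshapes]

/-- The first entry of a finite sequence, or `0` if the sequence is empty. -/
def headD {p : ℕ} (β : Fin p → ℕ) : ℕ := if h : 0 < p then β ⟨0, h⟩ else 0

theorem antitone_cons {p : ℕ} {b : ℕ} {β : Fin p → ℕ} :
    Antitone (Fin.cons b β : Fin (p + 1) → ℕ) ↔ headD β ≤ b ∧ Antitone β := by
  constructor
  · intro h
    refine ⟨?_, fun i j hij => by simpa using h (Fin.succ_le_succ_iff.2 hij)⟩
    unfold headD
    split_ifs with hp
    · have := h (Fin.zero_le (Fin.succ ⟨0, hp⟩))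
      rwa [Fin.cons_succ, Fin.cons_zero] at this
    · exact Nat.zero_le _
  · rintro ⟨hb, hβ⟩ i j hij
    induction i using Fin.cases with
    | zero =>
      induction j using Fin.cases with
      | zero => exact le_rfl
      | succ j =>
        have hp : 0 < p := by have := j.2; omega
        have : β j ≤ β ⟨0, hp⟩ := hβ (Fin.mk_le_of_le_val (Nat.zero_le _))
        simp only [headD, hp, dif_pos] at hb
        simpa using this.trans hb
    | succ i =>
      induction j using Fin.cases with
      | zero => simp at hij
      | succ j => simpa using hβ (Fin.succ_le_succ_iff.1 hij)

theorem sum_subshapes_succ {p : ℕ} (α : Fin (p + 1) → ℕ) (F : (Fin (p + 1) → ℕ) → R) :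
    ∑ β ∈ subshapes α, F β =
      ∑ β ∈ subshapes (Fin.tail α), ∑ b ∈ Finset.Icc (headD β) (α 0), F (Fin.cons b β) := by
  rw [Finset.sum_sigma']
  refine Finset.sum_bij' (fun β _ => ⟨Fin.tail β, β 0⟩) (fun q _ => Fin.cons q.2 q.1)
    ?_ ?_ ?_ ?_ ?_
  · intro β hβ
    rw [mem_subshapes] at hβ
    obtain ⟨h1, h2⟩ := antitone_cons.1 ((Fin.cons_self_tail β).symm ▸ hβ.2)
    simp only [Finset.mem_sigma, mem_subshapes, Finset.mem_Icc]
    exact ⟨⟨fun i => hβ.1 _, h2⟩, h1, hβ.1 0⟩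
  · rintro ⟨β, b⟩ h
    simp only [Finset.mem_sigma, mem_subshapes, Finset.mem_Icc] at h
    rw [mem_subshapes, antitone_cons]
    refine ⟨fun i => ?_, h.2.1, h.1.2⟩
    induction i using Fin.cases with
    | zero => simpa using h.2.2
    | succ i => simpa [Fin.tail] using h.1.1 i
  · intro β _; simp
  · rintro ⟨β, b⟩ _; simp
  · intro β _; simp

variable {V : Type*} [AddCommGroup V] [Module R V]

theorem shift_recurrence_iterate (t : ℕ → R) {u v : ℕ → V}
    (hrec : ∀ b, v (b + 1) = u b + t b • v b) {b a : ℕ} (hba : b ≤ a) :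
    v a = ∑ c ∈ Finset.Ico b a, (∏ r ∈ Finset.Ico (c + 1) a, t r) • u c +
      (∏ r ∈ Finset.Ico b a, t r) • v b := by
  induction a, hba using Nat.le_induction with
  | base => simp
  | succ a h ih =>
    rw [hrec, ih, Finset.sum_Ico_succ_top h, Finset.prod_Ico_succ_top h, smul_add,
      Finset.smul_sum, smul_smul, mul_comm (t a)]
    have : ∀ c ∈ Finset.Ico b a, (∏ r ∈ Finset.Ico (c + 1) (a + 1), t r) • u c =
        t a • (∏ r ∈ Finset.Ico (c + 1) a, t r) • u c := fun c hc => by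
      rw [Finset.mem_Ico] at hc
      rw [Finset.prod_Ico_succ_top (by omega), smul_smul, mul_comm]
    rw [Finset.sum_congr rfl this]
    simp
    abel

/-- If the rows satisfy the recurrence `v (i+1) (b+1) = v i b + t b • v (i+1) b`, then an
alternating form in the rows `v i (α i) + x • v (i+1) (α i)` expands over the weakly decreasing
sequences below `α` only. -/
theorem alternating_expand_subshapes (x : R) (t : ℕ → R) (v : ℕ → ℕ → V)
    (hrec : ∀ i b, v (i + 1) (b + 1) = v i b + t b • v (i + 1) b) (p : ℕ) :
    ∀ (s : ℕ), v (s + p) 0 = 0 → ∀ (f : V [⋀^Fin p]→ₗ[R] R) (α : Fin p → ℕ), Antitone α →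
      f (fun i => v (s + i) (α i) + x • v (s + i + 1) (α i)) =
        ∑ β ∈ subshapes α, (∏ i, stripWeight x t (β i) (α i)) *
          f (fun i => v (s + i) (β i)) := by
  induction p with
  | zero =>
    intro s _ f α _
    have : subshapes α = {α} := by
      ext β
      simp [mem_subshapes, Subsingleton.elim β α, Subsingleton.antitone]
    rw [this, Finset.sum_singleton]
    simp only [Finset.univ_eq_empty, Finset.prod_empty, one_mul]
    exact congrArg f (Subsingleton.elim _ _)
  | succ p ih =>
    intro s hz f α hα
    have hz' : v (s + 1 + p) 0 = 0 := by rwa [add_assoc, add_comm 1 p]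
    have hα' : Antitone (Fin.tail α) := fun i j hij => hα (Fin.succ_le_succ_iff.2 hij)
    have split : ∀ w : Fin (p + 1) → V, f w = f.curryLeft (w 0) (Fin.tail w) := fun w => by
      rw [AlternatingMap.curryLeft_apply_apply]
      exact congrArg f (Fin.cons_self_tail w).symm
    have step := ih (s + 1) hz'
      (f.curryLeft (v s (α 0) + x • v (s + 1) (α 0))) (Fin.tail α) hα'
    rw [sum_subshapes_succ, split]
    have e : ∀ i : Fin p, s + (i.succ : ℕ) = s + 1 + i := fun i => by simp; omega
    simp only [Fin.tail_def, Fin.val_zero, add_zero, e] at step ⊢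
    rw [step]
    refine Finset.sum_congr rfl fun β hβ => ?_
    rw [mem_subshapes] at hβ
    simp only [split _, Fin.tail_def, Fin.val_zero, add_zero, e, Fin.cons_zero, Fin.cons_succ,
      Fin.prod_univ_succ]
    set w : Fin p → V := fun i => v (s + 1 + i) (β i) with hw
    let g : V →ₗ[R] R :=
      { toFun := fun u => f.curryLeft u w
        map_add' := fun a b => by simp
        map_smul' := fun a b => by simp }
    have hg : ∀ u, f.curryLeft u w = g u := fun _ => rfl
    have hb : headD β ≤ α 0 := by
      unfold headD
      split_ifs with hp
      · exact (hβ.1 _).trans (hα (Fin.zero_le _))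
      · exact Nat.zero_le _
    have hzero : g (v (s + 1) (headD β)) = 0 := by
      unfold headD
      split_ifs with hp
      · rw [← hg, AlternatingMap.curryLeft_apply_apply]
        refine f.map_eq_zero_of_eq (i := 0) (j := Fin.succ ⟨0, hp⟩) _ ?_
          (Fin.succ_ne_zero _).symm
        simp [hw]
      · obtain rfl : p = 0 := by omega
        rw [show v (s + 1) 0 = 0 from hz, map_zero]
    have key : g (v s (α 0) + x • v (s + 1) (α 0)) =
        ∑ b ∈ Finset.Icc (headD β) (α 0), stripWeight x t b (α 0) * g (v s b) := by
      rw [map_add, map_smul, shift_recurrence_iterate t (hrec s) hb, map_add, map_smul, hzero,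
        smul_zero, add_zero, map_sum, ← Finset.Ico_insert_right hb,
        Finset.sum_insert (by simp), smul_eq_mul, Finset.mul_sum]
      congr 1
      · simp [stripWeight]
      · refine Finset.sum_congr rfl fun c hc => ?_
        rw [Finset.mem_Ico] at hc
        rw [stripWeight, if_neg (by omega), map_smul, smul_eq_mul, mul_assoc]
    rw [hg, key, Finset.mul_sum]
    refine Finset.sum_congr rfl fun b _ => ?_
    rw [hg]
    ring

end Expansion

section Elementary

theorem eL_eq_esymm (k : ℕ) (L : List R) : eL k L = (L : Multiset R).esymm k := by
  have hL : (L : Multiset R) = (Finset.univ : Finset (Fin L.length)).val.map L.get := by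
    rw [Fin.univ_val_map, List.ofFn_get]
  conv_rhs => rw [hL, Finset.esymm_map_val]
  refine Finset.sum_bij' (fun f _ => Finset.univ.image f)
    (fun s hs => s.orderEmbOfFin (Finset.mem_powersetCard.1 hs).2) ?_ ?_ ?_ ?_ ?_
  · intro f hf
    rw [Finset.mem_powersetCard, Finset.card_image_of_injective _
      (Finset.mem_filter.1 hf).2.injective]
    simp
  · intro s hs
    simpa using (s.orderEmbOfFin (Finset.mem_powersetCard.1 hs).2).strictMono
  · intro f hf
    exact (Finset.orderEmbOfFin_unique _ (by simp) (Finset.mem_filter.1 hf).2).symm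
  · intro s hs
    simp
  · intro f hf
    rw [Finset.prod_image ((Finset.mem_filter.1 hf).2.injective.injOn)]

/-- The elementary symmetric function of integer degree, zero in negative degrees. -/
def esymmInt (d : ℤ) (s : Multiset R) : R := if 0 ≤ d then s.esymm d.toNat else 0

theorem eInt_eq_esymmInt (d : ℤ) (L : List R) : eInt d L = esymmInt d (L : Multiset R) := by
  simp only [eInt, esymmInt, eL_eq_esymm]

theorem esymmInt_of_neg {d : ℤ} (h : d < 0) (s : Multiset R) : esymmInt d s = 0 :=
  if_neg (by omega)

theorem esymmInt_of_card_lt {d : ℤ} {s : Multiset R} (h : (s.card : ℤ) < d) :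
    esymmInt d s = 0 := by
  rw [esymmInt, if_pos (by omega), Multiset.esymm, Multiset.powersetCard_eq_empty _ (by omega)]
  simp

theorem esymmInt_zero (s : Multiset R) : esymmInt 0 s = 1 := by
  simp [esymmInt, Multiset.esymm]

theorem esymmInt_cons (d : ℤ) (a : R) (s : Multiset R) :
    esymmInt d (a ::ₘ s) = esymmInt d s + a * esymmInt (d - 1) s := by
  rcases lt_trichotomy d 0 with h | rfl | h
  · simp [esymmInt_of_neg, h, show d - 1 < 0 by omega]
  · simp [esymmInt_zero, esymmInt_of_neg]
  · obtain ⟨k, rfl⟩ : ∃ k : ℕ, d = k + 1 := ⟨(d - 1).toNat, by omega⟩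
    rw [esymmInt, esymmInt, esymmInt, if_pos h.le, if_pos h.le, if_pos (by omega)]
    rw [show ((k : ℤ) + 1).toNat = k + 1 by omega, show ((k : ℤ) + 1 - 1).toNat = k by omega]
    simp [Multiset.esymm, Multiset.powersetCard_cons, Multiset.map_map,
      Multiset.sum_map_mul_left]

/-- The multiset `x 1, …, x n, t 1, …, t (a - 1)`. -/
def alphabet (x t : ℕ → R) (n a : ℕ) : Multiset R :=
  (Multiset.range n).map (fun k => x (k + 1)) + (Multiset.range (a - 1)).map fun k => t (k + 1)

theorem card_alphabet {R : Type*} (x t : ℕ → R) (n a : ℕ) : (alphabet x t n a).card = n + (a - 1) := by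
  simp [alphabet]

theorem alphabet_succ_left {R : Type*} (x t : ℕ → R) (n a : ℕ) :
    alphabet x t (n + 1) a = x (n + 1) ::ₘ alphabet x t n a := by
  simp [alphabet, Multiset.range_succ]

theorem alphabet_add_two_right {R : Type*} (x t : ℕ → R) (n a : ℕ) :
    alphabet x t n (a + 2) = t (a + 1) ::ₘ alphabet x t n (a + 1) := by
  simp [alphabet, Multiset.range_succ]

/-- Row `i` of the dual Jacobi–Trudi matrix, for a column of length `a`. -/
def jtRow (x t : ℕ → R) (m n i a : ℕ) : Fin m → R :=
  fun j => esymmInt ((a : ℤ) + (j : ℤ) - (i : ℤ)) (alphabet x t n a)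

theorem jtRow_succ_alphabet (x t : ℕ → R) (m n i a : ℕ) :
    jtRow x t m (n + 1) i a = jtRow x t m n i a + x (n + 1) • jtRow x t m n (i + 1) a := by
  funext j
  simp only [jtRow, alphabet_succ_left, esymmInt_cons, Pi.add_apply, Pi.smul_apply, smul_eq_mul]
  push_cast
  rw [sub_add_eq_sub_sub]

theorem jtRow_succ_succ (x t : ℕ → R) (m n i a : ℕ) :
    jtRow x t m n (i + 1) (a + 1) =
      jtRow x t m n i a + (if a = 0 then 0 else t a) • jtRow x t m n (i + 1) a := by
  funext j
  simp only [jtRow, Pi.add_apply, Pi.smul_apply, smul_eq_mul]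
  cases a with
  | zero => simp [alphabet]; congr 1; ring
  | succ a =>
    simp only [alphabet_add_two_right, esymmInt_cons, Nat.succ_ne_zero, if_false]
    push_cast
    rw [show (a : ℤ) + 1 + 1 + j - (i + 1) = a + 1 + j - i by ring,
      show (a : ℤ) + 1 + j - i - 1 = a + 1 + j - (i + 1) by ring]

theorem jtRow_size_zero (x t : ℕ → R) (m n : ℕ) : jtRow x t m n m 0 = 0 := by
  funext j
  exact esymmInt_of_neg (by have := j.2; omega) _

/-- The dual Jacobi–Trudi determinant of the shape with column lengths `α`. -/
def jtDet (x t : ℕ → R) (n : ℕ) {m : ℕ} (α : Fin m → ℕ) : R :=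
  Matrix.detRowAlternating fun i : Fin m => jtRow x t m n i (α i)

theorem jtDet_succ (x t : ℕ → R) (n : ℕ) {m : ℕ} {α : Fin m → ℕ} (hα : Antitone α) :
    jtDet x t (n + 1) α = ∑ β ∈ subshapes α,
      (∏ i, stripWeight (x (n + 1)) (fun a => if a = 0 then 0 else t a) (β i) (α i)) *
        jtDet x t n β := by
  have h := alternating_expand_subshapes (x (n + 1)) (fun a => if a = 0 then 0 else t a)
    (jtRow x t m n) (jtRow_succ_succ x t m n) m 0 (by rw [zero_add, jtRow_size_zero])
    Matrix.detRowAlternating α hα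
  simp only [zero_add, ← jtRow_succ_alphabet] at h
  exact h

theorem jtDet_zero (x t : ℕ → R) {m : ℕ} {α : Fin m → ℕ} (hα : Antitone α) :
    jtDet x t 0 α = if α = 0 then 1 else 0 := by
  split_ifs with h
  · subst h
    have : (fun i : Fin m => jtRow x t m 0 i 0) = (1 : Matrix (Fin m) (Fin m) R) := by
      funext i j
      simp only [jtRow, Matrix.one_apply]
      split_ifs with hij
      · subst hij; simp [esymmInt_zero]
      · have : (i : ℕ) ≠ j := fun h => hij (Fin.ext h)
        rcases lt_or_gt_of_ne this with h | h
        · exact esymmInt_of_card_lt (by rw [card_alphabet]; omega)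
        · exact esymmInt_of_neg (by omega) _
    exact (congrArg Matrix.det this).trans Matrix.det_one
  · cases m with
    | zero => exact absurd (Subsingleton.elim _ _) h
    | succ m =>
      have h0 : α 0 ≠ 0 := fun h0 => h (funext fun i => by
        have := hα (Fin.zero_le i)
        simp only [Pi.zero_apply]
        omega)
      refine Matrix.det_eq_zero_of_row_eq_zero 0 fun j => ?_
      exact esymmInt_of_card_lt (by rw [card_alphabet]; simp; omega)

end Elementary

section Fillings

/-- A reverse plane partition with entries in `{1, …, n}` of the shape with column lengths `α`,
encoded column by column and extended by `0` outside the shape. -/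
def IsColumnRPP (n : ℕ) {m : ℕ} (α : Fin m → ℕ) (T : Fin m → ℕ → ℕ) : Prop :=
  (∀ c r, T c r = 0 ↔ α c ≤ r) ∧ (∀ c r, T c r ≤ n) ∧
  (∀ c r r', r ≤ r' → r' < α c → T c r ≤ T c r') ∧
  (∀ c c' r, c ≤ c' → r < α c' → T c r ≤ T c' r)

theorem finite_setOf_isColumnRPP (n : ℕ) {m : ℕ} (α : Fin m → ℕ) :
    {T | IsColumnRPP n α T}.Finite := by
  refine Set.Finite.of_finite_image (f := fun T (c : Fin m) (r : Fin (α c)) =>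
    Fin.ofNat (n + 1) (T c r)) (Set.toFinite _) ?_
  intro T hT T' hT' h
  funext c r
  by_cases hr : r < α c
  · have := congrArg Fin.val (congrFun (congrFun h c) ⟨r, hr⟩)
    simpa [Nat.mod_eq_of_lt (Nat.lt_succ_of_le (hT.2.1 c r)),
      Nat.mod_eq_of_lt (Nat.lt_succ_of_le (hT'.2.1 c r))] using this
  · rw [(hT.1 c r).2 (by omega), (hT'.1 c r).2 (by omega)]

/-- The finite set of reverse plane partitions with column lengths `α` and entries at most `n`. -/
def columnRPPs (n : ℕ) {m : ℕ} (α : Fin m → ℕ) : Finset (Fin m → ℕ → ℕ) :=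
  (finite_setOf_isColumnRPP n α).toFinset

theorem mem_columnRPPs {n m : ℕ} {α : Fin m → ℕ} {T : Fin m → ℕ → ℕ} :
    T ∈ columnRPPs n α ↔ IsColumnRPP n α T := by
  simp [columnRPPs]

/-- The weight of a column of length `a` with entries `T 0, …, T (a - 1)`. -/
def columnWeight (x t : ℕ → R) (a : ℕ) (T : ℕ → ℕ) : R :=
  ∏ r ∈ Finset.range a, if r + 1 < a ∧ T (r + 1) = T r then t (r + 1) else x (T r)

/-- Extend a column of length `b` to length `a` by the constant entry `e`. -/
def fillColumn (b a e : ℕ) (T : ℕ → ℕ) (r : ℕ) : ℕ :=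
  if r < b then T r else if r < a then e else 0

theorem columnWeight_fillColumn (x t : ℕ → R) {b a n : ℕ} (hba : b ≤ a) {T : ℕ → ℕ}
    (hT : ∀ r, T r ≤ n) :
    columnWeight x t a (fillColumn b a (n + 1) T) =
      stripWeight (x (n + 1)) (fun r => if r = 0 then 0 else t r) b a *
        columnWeight x t b T := by
  rcases hba.eq_or_lt with rfl | hlt
  · rw [stripWeight, if_pos rfl, one_mul]
    refine Finset.prod_congr rfl fun r hr => ?_
    rw [Finset.mem_range] at hr
    by_cases h : r + 1 < b <;> simp [fillColumn, hr, h]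
  · obtain ⟨d, rfl⟩ : ∃ d, a = d + 1 := ⟨a - 1, by omega⟩
    rw [columnWeight, ← Finset.prod_range_mul_prod_Ico _ hba, mul_comm]
    congr 1
    · rw [Finset.prod_Ico_succ_top (by omega), stripWeight, if_neg hlt.ne, mul_comm,
        ← Finset.prod_Ico_add' _ b d 1]
      congr 1
      · simp [fillColumn, show ¬ d < b by omega]
      · refine Finset.prod_congr rfl fun r hr => ?_
        rw [Finset.mem_Ico] at hr
        simp [fillColumn, show ¬ r < b by omega, show ¬ r + 1 < b by omega, hr.2,
          show r < d + 1 by omega]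
    · refine Finset.prod_congr rfl fun r hr => ?_
      rw [Finset.mem_range] at hr
      have := hT r
      by_cases h : r + 1 < b
      · simp [fillColumn, hr, h, show r < d by omega]
      · have h' : n + 1 ≠ T r := by omega
        simp [fillColumn, hr, h, h', show r < d by omega]

/-- The shape occupied by the entries at most `n`. -/
def lowShape (n : ℕ) {m : ℕ} (α : Fin m → ℕ) (T : Fin m → ℕ → ℕ) (c : Fin m) : ℕ :=
  ((Finset.range (α c)).filter fun r => T c r ≤ n).card

theorem lt_lowShape {n m : ℕ} {α : Fin m → ℕ} {T : Fin m → ℕ → ℕ}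
    (hT : IsColumnRPP (n + 1) α T) (c : Fin m) (r : ℕ) :
    r < lowShape n α T c ↔ r < α c ∧ T c r ≤ n :=
  mem_filter_range_card (fun r r' h h' h'' => (hT.2.2.1 c r r' h h').trans h'') r

theorem lowShape_mem_subshapes {n m : ℕ} {α : Fin m → ℕ} (hα : Antitone α)
    {T : Fin m → ℕ → ℕ} (hT : IsColumnRPP (n + 1) α T) : lowShape n α T ∈ subshapes α := by
  rw [mem_subshapes]
  refine ⟨fun c => le_of_forall_lt fun r hr => ((lt_lowShape hT c r).1 hr).1, fun c c' h => ?_⟩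
  refine le_of_forall_lt fun r hr => ?_
  rw [lt_lowShape hT] at hr ⊢
  exact ⟨hr.1.trans_le (hα h), (hT.2.2.2 c c' r h hr.1).trans hr.2⟩

theorem IsColumnRPP.truncate {n m : ℕ} {α : Fin m → ℕ} (hα : Antitone α)
    {T : Fin m → ℕ → ℕ} (hT : IsColumnRPP (n + 1) α T) :
    IsColumnRPP n (lowShape n α T) fun c r => if T c r ≤ n then T c r else 0 := by
  have key := lt_lowShape hT
  have hanti := (mem_subshapes.1 (lowShape_mem_subshapes hα hT)).2
  refine ⟨fun c r => ?_, fun c r => ?_, fun c r r' h h' => ?_, fun c c' r h h' => ?_⟩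
  · have h0 := hT.1 c r
    have := key c r
    dsimp only
    split_ifs with h <;> omega
  · dsimp only
    split_ifs with h <;> omega
  · have h1 := (key c r').1 h'
    have h2 := hT.2.2.1 c r r' h h1.1
    simpa [h1.2, h2.trans h1.2] using h2
  · have h1 := (key c' r).1 h'
    have h2 := hT.2.2.2 c c' r h h1.1
    simpa [h1.2, h2.trans h1.2] using h2

theorem IsColumnRPP.fill {n m : ℕ} {α β : Fin m → ℕ} (hα : Antitone α)
    (hβ : β ∈ subshapes α) {T : Fin m → ℕ → ℕ} (hT : IsColumnRPP n β T) :
    IsColumnRPP (n + 1) α fun c => fillColumn (β c) (α c) (n + 1) (T c) := by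
  rw [mem_subshapes] at hβ
  refine ⟨fun c r => ?_, fun c r => ?_, fun c r r' h h' => ?_, fun c c' r h h' => ?_⟩
  · have h0 := hT.1 c r
    have h1 := hβ.1 c
    simp only [fillColumn]
    grind
  · have h0 := hT.2.1 c r
    simp only [fillColumn]
    split_ifs <;> omega
  · have h0 := hT.2.1 c r
    have h1 := hT.2.2.1 c r r' h
    simp only [fillColumn]
    split_ifs <;> omega
  · have h0 := hT.2.1 c r
    have h1 := hT.2.2.2 c c' r h
    have h2 := hα h
    have h3 := hβ.2 h
    simp only [fillColumn]
    split_ifs <;> omega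

theorem lowShape_fill {n m : ℕ} {α β : Fin m → ℕ} (hα : Antitone α)
    (hβ : β ∈ subshapes α) {T : Fin m → ℕ → ℕ} (hT : IsColumnRPP n β T) :
    lowShape n α (fun c => fillColumn (β c) (α c) (n + 1) (T c)) = β := by
  funext c
  refine eq_of_forall_lt_iff fun r => ?_
  rw [lt_lowShape (hT.fill hα hβ)]
  have h0 := hT.2.1 c r
  have h1 := (mem_subshapes.1 hβ).1 c
  simp only [fillColumn]
  split_ifs <;> omega

theorem sum_columnRPPs_succ (x t : ℕ → R) (n : ℕ) {m : ℕ} {α : Fin m → ℕ} (hα : Antitone α) :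
    ∑ T ∈ columnRPPs (n + 1) α, ∏ c, columnWeight x t (α c) (T c) =
      ∑ β ∈ subshapes α,
        (∏ i, stripWeight (x (n + 1)) (fun a => if a = 0 then 0 else t a) (β i) (α i)) *
          ∑ T ∈ columnRPPs n β, ∏ c, columnWeight x t (β c) (T c) := by
  simp only [Finset.mul_sum]
  rw [Finset.sum_sigma']
  symm
  refine Finset.sum_bij' (fun q _ c => fillColumn (q.1 c) (α c) (n + 1) (q.2 c))
    (fun T _ => ⟨lowShape n α T, fun c r => if T c r ≤ n then T c r else 0⟩) ?_ ?_ ?_ ?_ ?_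
  · rintro ⟨β, T⟩ h
    rw [Finset.mem_sigma, mem_columnRPPs] at h
    exact mem_columnRPPs.2 (h.2.fill hα h.1)
  · intro T hT
    rw [mem_columnRPPs] at hT
    rw [Finset.mem_sigma, mem_columnRPPs]
    exact ⟨lowShape_mem_subshapes hα hT, hT.truncate hα⟩
  · rintro ⟨β, T⟩ h
    rw [Finset.mem_sigma, mem_columnRPPs] at h
    obtain ⟨hβ, hT⟩ := h
    have e := lowShape_fill hα hβ hT
    dsimp only at e ⊢
    rw [e]
    congr 1
    funext c r
    have h0 := hT.2.1 c r
    have h1 := hT.1 c r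
    dsimp only at h0 h1 ⊢
    simp only [fillColumn]
    split_ifs <;> omega
  · intro T hT
    rw [mem_columnRPPs] at hT
    funext c r
    have h0 := hT.2.1 c r
    have h1 := hT.1 c r
    have h2 := lt_lowShape hT c r
    simp only [fillColumn]
    split_ifs <;> omega
  · rintro ⟨β, T⟩ h
    rw [Finset.mem_sigma, mem_columnRPPs] at h
    rw [← Finset.prod_mul_distrib]
    refine Finset.prod_congr rfl fun c _ => ?_
    rw [columnWeight_fillColumn x t ((mem_subshapes.1 h.1).1 c) (h.2.2.1 c)]

theorem sum_columnRPPs_zero (x t : ℕ → R) {m : ℕ} (α : Fin m → ℕ) :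
    ∑ T ∈ columnRPPs 0 α, ∏ c, columnWeight x t (α c) (T c) = if α = 0 then 1 else 0 := by
  split_ifs with h
  · subst h
    have : columnRPPs 0 (0 : Fin m → ℕ) = {0} := by
      ext T
      rw [mem_columnRPPs, Finset.mem_singleton]
      refine ⟨fun hT => funext fun c => funext fun r => Nat.le_zero.1 (hT.2.1 c r), ?_⟩
      rintro rfl
      simp [IsColumnRPP]
    simp [this, columnWeight]
  · have : columnRPPs 0 α = ∅ := by
      refine Finset.eq_empty_of_forall_notMem fun T hT => h (funext fun c => ?_)
      rw [mem_columnRPPs] at hT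
      exact Nat.le_zero.1 ((hT.1 c 0).1 (Nat.le_zero.1 (hT.2.1 c 0)))
    simp [this]

theorem sum_columnRPPs_eq_jtDet (x t : ℕ → R) (n : ℕ) {m : ℕ} {α : Fin m → ℕ}
    (hα : Antitone α) :
    ∑ T ∈ columnRPPs n α, ∏ c, columnWeight x t (α c) (T c) = jtDet x t n α := by
  induction n generalizing α with
  | zero => rw [sum_columnRPPs_zero, jtDet_zero x t hα]
  | succ n ih =>
    rw [sum_columnRPPs_succ x t n hα, jtDet_succ x t n hα]
    exact Finset.sum_congr rfl fun β hβ => by rw [ih (mem_subshapes.1 hβ).2]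

end Fillings

section Conjugation

variable {ℓ n : ℕ} {lam : ℕ → ℕ}

theorem lt_conjugate (hlam : ∀ i j : ℕ, i ≤ j → j < ℓ → lam j ≤ lam i) (c r : ℕ) :
    r < conjugate ℓ lam (c + 1) ↔ r < ℓ ∧ c < lam r :=
  mem_filter_range_card (P := fun r => c + 1 ≤ lam r)
    (fun r r' h h' h'' => le_trans h'' (hlam r r' h h')) r

theorem conjugate_antitone (hlam : ∀ i j : ℕ, i ≤ j → j < ℓ → lam j ≤ lam i) :
    Antitone fun c : Fin (lam 0) => conjugate ℓ lam (c + 1) := by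
  refine fun c c' h => le_of_forall_lt fun r hr => ?_
  rw [lt_conjugate hlam] at hr ⊢
  exact ⟨hr.1, lt_of_le_of_lt h hr.2⟩

/-- The column encoding of a filling, extended by `0` outside the shape. -/
def toColumns (T : YBox ℓ lam → Fin (n + 1)) (c : Fin (lam 0)) (r : ℕ) : ℕ :=
  if h : r < ℓ ∧ (c : ℕ) < lam r then T ⟨⟨r, h.1⟩, ⟨c, h.2⟩⟩ else 0

theorem toColumns_box (hlam : ∀ i j : ℕ, i ≤ j → j < ℓ → lam j ≤ lam i)
    (T : YBox ℓ lam → Fin (n + 1)) (b : YBox ℓ lam) :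
    toColumns T ⟨b.2, b.2.2.trans_le (hlam 0 b.1 (Nat.zero_le _) b.1.2)⟩ b.1 = T b := by
  rw [toColumns, dif_pos ⟨b.1.2, b.2.2⟩]

theorem isColumnRPP_toColumns (hlam : ∀ i j : ℕ, i ≤ j → j < ℓ → lam j ≤ lam i)
    {T : YBox ℓ lam → Fin (n + 1)} (hT : IsSkewRPP ℓ n lam (fun _ => 0) T) :
    IsColumnRPP n (fun c : Fin (lam 0) => conjugate ℓ lam (c + 1)) (toColumns T) := by
  obtain ⟨h0, hrow, hcol⟩ := hT
  refine ⟨fun c r => ?_, fun c r => ?_, fun c r r' h h' => ?_, fun c c' r h h' => ?_⟩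
  · rw [← not_lt, lt_conjugate hlam, toColumns]
    split_ifs with h
    · simpa [h] using h0 ⟨⟨r, h.1⟩, ⟨c, h.2⟩⟩
    · simp [h]
  · rw [toColumns]
    split_ifs
    · exact Nat.lt_succ_iff.1 (Fin.is_lt _)
    · exact Nat.zero_le _
  · rw [lt_conjugate hlam] at h'
    have hr : r < ℓ ∧ (c : ℕ) < lam r := ⟨by omega, h'.2.trans_le (hlam r r' h h'.1)⟩
    rw [toColumns, toColumns, dif_pos hr, dif_pos h']
    exact hcol ⟨r, hr.1⟩ ⟨r', h'.1⟩ ⟨c, hr.2⟩ ⟨c, h'.2⟩ h rfl (Nat.zero_le _) (Nat.zero_le _)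
  · rw [lt_conjugate hlam] at h'
    have hr : r < ℓ ∧ (c : ℕ) < lam r := ⟨h'.1, lt_of_le_of_lt h h'.2⟩
    rw [toColumns, toColumns, dif_pos hr, dif_pos h']
    exact hrow ⟨r, hr.1⟩ ⟨c, hr.2⟩ ⟨c', h'.2⟩ (Nat.zero_le _) h

theorem isSkewRPP_of_isColumnRPP (hlam : ∀ i j : ℕ, i ≤ j → j < ℓ → lam j ≤ lam i)
    {T : YBox ℓ lam → Fin (n + 1)}
    (hT : IsColumnRPP n (fun c : Fin (lam 0) => conjugate ℓ lam (c + 1)) (toColumns T)) :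
    IsSkewRPP ℓ n lam (fun _ => 0) T := by
  obtain ⟨h0, -, hcol, hrow⟩ := hT
  refine ⟨fun b => ?_, fun r c c' _ h => ?_, fun r r' c c' h hc _ _ => ?_⟩
  · rw [← toColumns_box hlam, h0, ← not_lt, lt_conjugate hlam]
    simp
  · rw [Fin.le_def, ← toColumns_box hlam, ← toColumns_box hlam]
    exact hrow _ _ _ h ((lt_conjugate hlam _ _).2 ⟨r.2, c'.2⟩)
  · rw [Fin.le_def, ← toColumns_box hlam, ← toColumns_box hlam]
    simp only [hc]
    exact hcol _ _ _ h ((lt_conjugate hlam _ _).2 ⟨r'.2, c'.2⟩)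

theorem prod_boxWeight (hlam : ∀ i j : ℕ, i ≤ j → j < ℓ → lam j ≤ lam i) (x t : ℕ → R)
    (T : YBox ℓ lam → Fin (n + 1)) :
    ∏ b : YBox ℓ lam, boxWeight ℓ n lam (fun _ => 0) x t T b =
      ∏ c : Fin (lam 0), columnWeight x t (conjugate ℓ lam (c + 1)) (toColumns T c) := by
  simp only [columnWeight]
  rw [Finset.prod_sigma']
  refine Finset.prod_bij'
    (fun b _ => ⟨⟨b.2, b.2.2.trans_le (hlam 0 b.1 (Nat.zero_le _) b.1.2)⟩, b.1⟩)
    (fun q hq =>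
      have h := (lt_conjugate hlam _ _).1 (Finset.mem_range.1 (Finset.mem_sigma.1 hq).2)
      ⟨⟨q.2, h.1⟩, ⟨q.1, h.2⟩⟩) ?_ ?_ ?_ ?_ ?_
  · intro b _
    simp [lt_conjugate hlam]
  · intro q hq; exact Finset.mem_univ _
  · intro b _; rfl
  · intro q hq; rfl
  · rintro b -
    rw [boxWeight, if_pos (Nat.zero_le _), toColumns_box hlam]
    simp only [lt_conjugate hlam]
    refine if_congr ⟨?_, ?_⟩ rfl rfl
    · rintro ⟨hr, hc, h⟩
      exact ⟨⟨hr, hc⟩, by rw [toColumns, dif_pos ⟨hr, hc⟩, h]⟩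
    · rintro ⟨⟨hr, hc⟩, h⟩
      rw [toColumns, dif_pos ⟨hr, hc⟩] at h
      exact ⟨hr, hc, Fin.ext h⟩

theorem dualGroth_eq_sum_columnRPPs (hlam : ∀ i j : ℕ, i ≤ j → j < ℓ → lam j ≤ lam i)
    (x t : ℕ → R) :
    dualGroth ℓ n lam (fun _ => 0) x t =
      ∑ T ∈ columnRPPs n fun c : Fin (lam 0) => conjugate ℓ lam (c + 1),
        ∏ c : Fin (lam 0), columnWeight x t (conjugate ℓ lam (c + 1)) (T c) := by
  refine Finset.sum_nbij toColumns (fun T hT => ?_) ?_ ?_ fun T _ => prod_boxWeight hlam x t T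
  · exact mem_columnRPPs.2 (isColumnRPP_toColumns hlam (Finset.mem_filter.1 hT).2)
  · intro T _ T' _ h
    funext b
    rw [Fin.ext_iff, ← toColumns_box hlam, ← toColumns_box hlam, h]
  · intro S hS
    have hS := mem_columnRPPs.1 hS
    let T : YBox ℓ lam → Fin (n + 1) := fun b =>
      ⟨S ⟨b.2, b.2.2.trans_le (hlam 0 b.1 (Nat.zero_le _) b.1.2)⟩ b.1,
        Nat.lt_succ_of_le (hS.2.1 _ _)⟩
    have hTS : toColumns T = S := by
      funext c r
      rw [toColumns]
      split_ifs with h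
      · rfl
      · rw [eq_comm, hS.1, ← not_lt, lt_conjugate hlam]
        exact h
    refine ⟨T, ?_, hTS⟩
    exact Finset.mem_filter.2 ⟨Finset.mem_univ _, isSkewRPP_of_isColumnRPP hlam (hTS ▸ hS)⟩

end Conjugation

/-- **Dual Jacobi–Trudi formula for refined dual Grothendieck polynomials.**
For a partition `λ = (λ_1 ≥ … ≥ λ_ℓ ≥ 0)` with conjugate `λ'`,
`g_λ(x_1,…,x_n; t_1,…,t_{ℓ-1})
  = det[ e_{λ'_i + j - i}(x_1,…,x_n,t_1,…,t_{λ'_i - 1}) ]_{i,j=1}^{λ_1}`. -/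
theorem refined_dual_grothendieck_dual_jacobi_trudi
    {R : Type*} [CommRing R] (ℓ n : ℕ) (hl : 1 ≤ ℓ) (lam : ℕ → ℕ)
    (hlam : ∀ i j : ℕ, i ≤ j → j < ℓ → lam j ≤ lam i)
    (x t : ℕ → R) :
    dualGroth ℓ n lam (fun _ => 0) x t =
      Matrix.det (Matrix.of fun i j : Fin (lam 0) =>
        eInt ((conjugate ℓ lam (i.1 + 1) : ℤ) + (j.1 : ℤ) - (i.1 : ℤ))
          (((List.range n).map fun k => x (k + 1)) ++
            ((List.range (conjugate ℓ lam (i.1 + 1) - 1)).map fun k => t (k + 1)))) := by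
  rw [dualGroth_eq_sum_columnRPPs hlam, sum_columnRPPs_eq_jtDet x t n (conjugate_antitone hlam)]
  refine congrArg Matrix.det (Matrix.ext fun i j => ?_)
  simp only [jtRow, Matrix.of_apply, eInt_eq_esymmInt, alphabet]
  rfl

end
end
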